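/- Let f_{E2} ∈ (RatFunc ℚ)[x] be the polynomial f_{E2}(t,x) = (1-t)·(x^6 - 20x^5 + 262x^4 - 15286x^3 + 477665x^2 - 10170814x + 96944940)^3·(x^6 + 60x^5 + 2406x^4 + 56114x^3 + 1941921x^2 + 55625130x + 996578748) + t·(x^12 + 396x^10 - 27192x^9 + 933174x^8 - 20101752x^7 + 169737744x^6 - 16330240872x^5 + 538400028969x^4 - 8234002812376x^3 + 195276967064388x^2 - 3991355037576144x + 30911476378259268)^2 + 2^4·3^12·11^22·t·(t-1), where t denotes the generator of the rational function field ℚ(t). Then the Galois group of f_{E2} over ℚ(t) has cardinality 190080 (the order of the group M₁₂.2 = Aut(M₁₂)). -/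

import Mathlib

open Polynomial

/-! ### Multiply transitive groups of degree twelve -/

section MultiplyTransitive

variable (G X : Type*) [Group G] [MulAction G X]

/-- Some element of `G` fixes a set of `c` points and all its cycles outside this set have length
divisible by `n`. -/
def HasCycles (c n : ℕ) : Prop :=
  ∃ g : G, ∃ F : Finset X, F.card = c ∧ (∀ x ∈ F, g • x = x) ∧
    ∀ x ∉ F, n ∣ Function.minimalPeriod (g • ·) x

variable {G X}

theorem dvd_card_of_dvd_minimalPeriod [Finite G] [DecidableEq X] (g : G) (n : ℕ) (A : Finset X)
    (hA : ∀ x ∈ A, g • x ∈ A) (hn : ∀ x ∈ A, n ∣ Function.minimalPeriod (g • ·) x) :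
    n ∣ A.card := by
  classical
  have hpow : ∀ z : Subgroup.zpowers g, ∀ x ∈ A, z • x ∈ A := by
    rintro ⟨z, hz⟩ x hx
    obtain ⟨k, rfl⟩ := (mem_powers_iff_mem_zpowers (x := g)).2 hz
    change (g ^ k) • x ∈ A
    induction k with
    | zero => simpa using hx
    | succ k ih => rw [pow_succ', mul_smul]; exact hA _ (ih (mem_powers_iff_mem_zpowers.1 ⟨k, rfl⟩))
  let f : X → MulAction.orbitRel.Quotient (Subgroup.zpowers g) X := Quotient.mk _
  rw [Finset.card_eq_sum_card_fiberwise (f := f) (t := A.image f)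
    fun x hx => by simpa using ⟨x, hx, rfl⟩]
  refine Finset.dvd_sum fun b hb => ?_
  obtain ⟨x, hx, rfl⟩ := Finset.mem_image.1 hb
  have horb : ((A.filter fun y => f y = f x : Finset X) : Set X) =
      MulAction.orbit (Subgroup.zpowers g) x := by
    ext y
    simp only [Finset.coe_filter, Set.mem_ofPred_eq]
    rw [show f y = f x ↔ y ∈ MulAction.orbit (Subgroup.zpowers g) x from
      Quotient.eq.trans MulAction.orbitRel_apply]
    refine ⟨fun h => h.2, fun h => ⟨?_, h⟩⟩
    obtain ⟨z, rfl⟩ := h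
    exact hpow z x hx
  have h2 := hn x hx
  have : Fintype (MulAction.orbit (Subgroup.zpowers g) x) := by
    rw [← horb]; exact Finset.fintypeCoeSort _
  rw [MulAction.minimalPeriod_eq_card, ← Nat.card_eq_fintype_card, Nat.card_coe_set_eq, ← horb,
    Set.ncard_coe_finset] at h2
  exact h2

variable (G X) in
/-- Any injective `k`-tuple can be moved to any other. -/
def TupleTransitive (k : ℕ) : Prop :=
  ∀ u v : Fin k → X, u.Injective → v.Injective → ∃ g : G, ∀ i, g • u i = v i

theorem HasCycles.exists_of_tupleTransitive {c n k : ℕ} (h : HasCycles G X c n)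
    (hk : TupleTransitive G X k) (hkc : k ≤ c) (u : Fin k → X) (hu : u.Injective) :
    ∃ g : G, (∀ i, g • u i = u i) ∧ ∃ F : Finset X, F.card = c ∧ (∀ i, u i ∈ F) ∧
      (∀ x ∈ F, g • x = x) ∧ ∀ x ∉ F, n ∣ Function.minimalPeriod (g • ·) x := by
  classical
  obtain ⟨g, F, hF, hg, hn⟩ := h
  have e : Fin k → X := fun i => (F.equivFin.symm (Fin.castLE (hF ▸ hkc) i) : X)
  let e : Fin k → X := fun i => (F.equivFin.symm (Fin.castLE (hF ▸ hkc) i) : X)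
  have he : e.Injective := fun i j hij => by
    simpa [e, Subtype.val_inj] using hij
  obtain ⟨a, ha⟩ := hk e u he hu
  refine ⟨a * g * a⁻¹, fun i => ?_, F.image (a • ·), ?_, fun i => ?_, ?_, ?_⟩
  · rw [← ha, mul_smul, mul_smul, inv_smul_smul, hg _ (Subtype.coe_prop _)]
  · rw [Finset.card_image_of_injective _ (MulAction.injective a), hF]
  · exact Finset.mem_image.2 ⟨e i, Subtype.coe_prop _, ha i⟩
  · intro x hx
    obtain ⟨y, hy, rfl⟩ := Finset.mem_image.1 hx
    simp only [mul_smul, inv_smul_smul, hg y hy]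
  · intro x hx
    have hx' : a⁻¹ • x ∉ F := fun h => hx (Finset.mem_image.2 ⟨_, h, smul_inv_smul a x⟩)
    convert hn _ hx' using 1
    refine Function.minimalPeriod_eq_minimalPeriod_iff.2 fun m => ?_
    have h1 : ∀ (b : G) (y : X), Function.IsPeriodicPt (b • ·) m y ↔ b ^ m • y = y := by
      intro b y
      rw [Function.IsPeriodicPt, Function.IsFixedPt, smul_iterate]
    rw [h1, h1, conj_pow, mul_smul, mul_smul, smul_eq_iff_eq_inv_smul]

variable [Finite G] [Fintype X]

/-- The orbit of `x` under the pointwise stabilizer of the tuple `u`. -/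
noncomputable def tupleOrbit (G : Type*) [Group G] [MulAction G X] {k : ℕ} (u : Fin k → X)
    (x : X) : Finset X :=
  open Classical in Finset.univ.filter fun y => ∃ g : G, (∀ i, g • u i = u i) ∧ g • x = y

omit [Finite G] in
theorem mem_tupleOrbit {k : ℕ} {u : Fin k → X} {x y : X} :
    y ∈ tupleOrbit G u x ↔ ∃ g : G, (∀ i, g • u i = u i) ∧ g • x = y := by
  simp [tupleOrbit]

theorem HasCycles.card_tupleOrbit {c n k : ℕ} (h : HasCycles G X c n)
    (hk : TupleTransitive G X k) (hkc : k ≤ c) (u : Fin k → X) (hu : u.Injective) (x : X)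
    (hx : ∀ i, u i ≠ x) : ∃ m r, r + k ≤ c ∧ (tupleOrbit G u x).card = n * m + r := by
  classical
  obtain ⟨g, hgu, F, hF, huF, hgF, hn⟩ := h.exists_of_tupleTransitive hk hkc u hu
  set O := tupleOrbit G u x
  have h1 : n ∣ (O \ F).card := by
    refine dvd_card_of_dvd_minimalPeriod g n _ (fun y hy => ?_)
      fun y hy => hn y (Finset.mem_sdiff.1 hy).2
    obtain ⟨hy, hyF⟩ := Finset.mem_sdiff.1 hy
    refine Finset.mem_sdiff.2 ⟨?_, fun h => hyF ?_⟩
    · obtain ⟨a, ha, rfl⟩ := mem_tupleOrbit.1 hy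
      exact mem_tupleOrbit.2 ⟨g * a, fun i => by rw [mul_smul, ha, hgu], mul_smul _ _ _⟩
    · have h2 : g • y = y := MulAction.injective g (hgF _ h)
      rwa [h2] at h
  obtain ⟨m, hm⟩ := h1
  refine ⟨m, (O ∩ F).card, ?_, ?_⟩
  · have : (O ∩ F).card + (Finset.univ.image u).card ≤ F.card := by
      rw [← Finset.card_union_of_disjoint]
      · refine Finset.card_le_card (Finset.union_subset Finset.inter_subset_right ?_)
        intro y hy
        obtain ⟨i, -, rfl⟩ := Finset.mem_image.1 hy
        exact huF i
      · rw [Finset.disjoint_left]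
        intro y hy hy'
        obtain ⟨i, -, rfl⟩ := Finset.mem_image.1 hy'
        obtain ⟨a, ha, hax⟩ := mem_tupleOrbit.1 (Finset.mem_inter.1 hy).1
        exact hx i (MulAction.injective a ((ha i).trans hax.symm))
    rwa [Finset.card_image_of_injective _ hu, Finset.card_fin, hF] at this
  · rw [← hm, Finset.card_sdiff_add_card_inter]

theorem TupleTransitive.succ {k : ℕ} (hk : TupleTransitive G X k)
    (h : ∀ (u : Fin k → X) (x : X), u.Injective → (∀ i, u i ≠ x) → 0 < (tupleOrbit G u x).card →
      (tupleOrbit G u x).card + k ≤ Fintype.card X → (tupleOrbit G u x).card + k = Fintype.card X) :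
    TupleTransitive G X (k + 1) := by
  classical
  have key : ∀ (u : Fin k → X) (x y : X), u.Injective → (∀ i, u i ≠ x) → (∀ i, u i ≠ y) →
      ∃ g : G, (∀ i, g • u i = u i) ∧ g • x = y := by
    intro u x y hu hx hy
    have hd : Disjoint (tupleOrbit G u x) (Finset.univ.image u) := by
      rw [Finset.disjoint_left]
      intro y hy hy'
      obtain ⟨i, -, rfl⟩ := Finset.mem_image.1 hy'
      obtain ⟨a, ha, hax⟩ := mem_tupleOrbit.1 hy
      exact hx i (MulAction.injective a ((ha i).trans hax.symm))
    have hc := Finset.card_union_of_disjoint hd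
    rw [Finset.card_image_of_injective _ hu, Finset.card_fin] at hc
    have h2 := h u x hu hx
      (Finset.card_pos.2 ⟨x, mem_tupleOrbit.2 ⟨1, by simp, one_smul _ _⟩⟩)
      (hc ▸ Finset.card_le_univ _)
    have h3 := (Finset.card_eq_iff_eq_univ _).1 (hc.trans h2)
    have h4 := Finset.mem_univ y
    rw [← h3, Finset.mem_union] at h4
    refine mem_tupleOrbit.1 (h4.resolve_right fun h5 => ?_)
    obtain ⟨i, -, h5⟩ := Finset.mem_image.1 h5
    exact hy i h5
  intro u v hu hv
  obtain ⟨g, hg⟩ := hk (Fin.init u) (Fin.init v) (hu.comp (Fin.castSucc_injective k))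
    (hv.comp (Fin.castSucc_injective k))
  have hu' : ∀ i, Fin.init v i ≠ g • u (Fin.last k) := fun i h => by
    rw [← hg, smul_left_cancel_iff] at h
    exact (Fin.castSucc_lt_last i).ne (hu h)
  obtain ⟨a, ha, hax⟩ := key (Fin.init v) (g • u (Fin.last k)) (v (Fin.last k))
    (hv.comp (Fin.castSucc_injective k)) hu'
    (fun i h => (Fin.castSucc_lt_last i).ne (hv h))
  refine ⟨a * g, fun i => ?_⟩
  rw [mul_smul]
  refine Fin.lastCases ?_ (fun i => ?_) i
  · exact hax
  · rw [show g • u i.castSucc = _ from hg i]; exact ha i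

theorem tupleTransitive_four (hX : Fintype.card X = 12) (h02 : HasCycles G X 0 2)
    (h11 : HasCycles G X 1 11) (h25 : HasCycles G X 2 5) (h22 : HasCycles G X 2 2)
    (h33 : HasCycles G X 3 3) (h44 : HasCycles G X 4 4) :
    TupleTransitive G X 1 ∧ TupleTransitive G X 2 ∧ TupleTransitive G X 3 ∧
      TupleTransitive G X 4 := by
  have t0 : TupleTransitive G X 0 := fun u v _ _ => ⟨1, fun i => i.elim0⟩
  have t1 : TupleTransitive G X 1 := t0.succ fun u x hu hx h0 h1 => by
    obtain ⟨m, r, hr, hm⟩ := h02.card_tupleOrbit t0 (by lia) u hu x hx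
    obtain ⟨m', r', hr', hm'⟩ := h11.card_tupleOrbit t0 (by lia) u hu x hx
    lia
  have t2 : TupleTransitive G X 2 := t1.succ fun u x hu hx h0 h1 => by
    obtain ⟨m', r', hr', hm'⟩ := h11.card_tupleOrbit t1 (by lia) u hu x hx
    lia
  have t3 : TupleTransitive G X 3 := t2.succ fun u x hu hx h0 h1 => by
    obtain ⟨m, r, hr, hm⟩ := h22.card_tupleOrbit t2 (by lia) u hu x hx
    obtain ⟨m', r', hr', hm'⟩ := h25.card_tupleOrbit t2 (by lia) u hu x hx
    lia
  refine ⟨t1, t2, t3, t3.succ fun u x hu hx h0 h1 => ?_⟩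
  obtain ⟨m, r, hr, hm⟩ := h33.card_tupleOrbit t3 (by lia) u hu x hx
  obtain ⟨m', r', hr', hm'⟩ := h44.card_tupleOrbit t3 (by lia) u hu x hx
  lia

/-- The pointwise stabilizer of a tuple. -/
def tupleStabilizer (G : Type*) [Group G] [MulAction G X] {k : ℕ} (u : Fin k → X) :
    Subgroup G where
  carrier := {g | ∀ i, g • u i = u i}
  one_mem' i := one_smul _ _
  mul_mem' ha hb i := by rw [mul_smul, hb, ha]
  inv_mem' ha i := by rw [inv_smul_eq_iff, ha]

omit [Finite G] in
theorem TupleTransitive.card_eq {k : ℕ} (hk : TupleTransitive G X k) (u : Fin k → X)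
    (hu : u.Injective) :
    Nat.card G = (Fintype.card X).descFactorial k * Nat.card (tupleStabilizer G u) := by
  classical
  let u' : Fin k ↪ X := ⟨u, hu⟩
  have ho : MulAction.orbit G u' = Set.univ := by
    refine Set.eq_univ_of_forall fun v => ?_
    obtain ⟨g, hg⟩ := hk u v hu v.injective
    exact ⟨g, Function.Embedding.ext hg⟩
  have hs : tupleStabilizer G u = MulAction.stabilizer G u' := by
    ext g
    simp only [MulAction.mem_stabilizer_iff, DFunLike.ext_iff]
    rfl
  rw [hs, mul_comm, ← Subgroup.card_mul_index (MulAction.stabilizer G u'),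
    MulAction.index_stabilizer, ho, Set.ncard_univ,
    Nat.card_eq_fintype_card (α := Fin k ↪ X), Fintype.card_embedding_eq, Fintype.card_fin]

theorem dvd_card_tupleStabilizer {k n : ℕ} (u : Fin k → X) (g : G) (hg : ∀ i, g • u i = u i)
    (x : X) (hx : n ∣ Function.minimalPeriod (g • ·) x) :
    ∃ a : tupleStabilizer G u, n ∣ orderOf a := by
  have hg' : g ∈ tupleStabilizer G u := hg
  refine ⟨⟨g, hg'⟩, hx.trans ?_⟩
  rw [Subgroup.orderOf_mk]
  refine Function.IsPeriodicPt.minimalPeriod_dvd ?_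
  rw [Function.IsPeriodicPt, Function.IsFixedPt, smul_iterate, pow_orderOf_eq_one]
  exact one_smul G x

theorem card_ne_of_tupleTransitive [FaithfulSMul G X] (hX : Fintype.card X = 12)
    (t2 : TupleTransitive G X 2) (t4 : TupleTransitive G X 4)
    (h8 : ∃ g : G, ∃ F : Finset X, F.card = 2 ∧ (∀ x ∈ F, g • x = x) ∧
      ∃ x : X, 8 ∣ Function.minimalPeriod (g • ·) x) :
    Nat.card G ≠ 47520 := by
  classical
  intro hG
  obtain ⟨g, F, hF, hg, x, hx⟩ := h8
  let u : Fin 2 → X := fun i => (F.equivFin.symm (Fin.cast hF.symm i) : X)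
  have hu : u.Injective := fun i j hij => by
    simpa [u, Subtype.val_inj] using hij
  let S := tupleStabilizer G u
  have hS : Nat.card S = 360 := by
    have := t2.card_eq u hu
    rw [hG, hX] at this
    norm_num [Nat.descFactorial] at this
    lia
  obtain ⟨a, ha⟩ := dvd_card_tupleStabilizer u g (fun i => hg _ (Subtype.coe_prop _)) x hx
  obtain ⟨b, hb⟩ : ∃ b : S, orderOf b = 8 := by
    exact ⟨a ^ (orderOf a / 8),
      orderOf_pow_orderOf_div (isOfFinOrder_of_finite a).orderOf_pos.ne' ha⟩
  have : Fact (Nat.Prime 2) := ⟨Nat.prime_two⟩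
  have hf : (360 : ℕ).factorization 2 = 3 := by
    rw [show (360 : ℕ) = 2 ^ 3 * 45 by norm_num, Nat.factorization_mul (by norm_num) (by norm_num),
      Nat.Prime.factorization_pow Nat.prime_two, Finsupp.add_apply, Finsupp.single_eq_same,
      Nat.factorization_eq_zero_of_not_dvd (by norm_num)]
  have hbc : Nat.card (Subgroup.zpowers b) = 2 ^ (Nat.card S).factorization 2 := by
    rw [Nat.card_zpowers, hb, hS, hf]; rfl
  let P : Sylow 2 S := Sylow.ofCard (Subgroup.zpowers b) hbc
  have hP : IsCyclic P := Subgroup.isCyclic_zpowers b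
  have hmin : (Nat.card S).minFac = 2 := by
    rw [hS]; exact (Nat.minFac_eq_two_iff _).2 (by norm_num)
  have hN := IsCyclic.isComplement' hmin hP
  set N := (MonoidHom.transferSylow P (hP.normalizer_le_centralizer hmin)).ker
  have hNc : Nat.card N = 45 := by
    have h := hN.card_mul_card
    rw [show Nat.card P = 8 from (Nat.card_zpowers b).trans hb, hS] at h
    lia
  have : Nontrivial N := (Finite.one_lt_card_iff_nontrivial).1 (by rw [hNc]; norm_num)
  obtain ⟨n, hn⟩ := exists_ne (1 : N)
  obtain ⟨x, hx⟩ : ∃ x : X, n • x ≠ x := by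
    by_contra! h
    apply hn
    have : ((n : S) : G) = 1 := eq_of_smul_eq_smul fun x : X => (h x).trans (one_smul _ _).symm
    exact Subtype.ext (Subtype.ext this)
  have hux : ∀ i, u i ≠ x := fun i h => hx (h ▸ (n : S).2 i)
  have hunx : ∀ i, u i ≠ n • x := fun i h => hux i
    (MulAction.injective n (show n • u i = n • x from ((n : S).2 i).trans h))
  have key : ∀ y, (∀ i, u i ≠ y) → y ≠ x → y ∈ MulAction.orbit N x := by
    intro y huy hyx
    let w (z : X) : Fin 4 → X :=
      Fin.snoc (α := fun _ => X) (Fin.snoc (α := fun _ => X) u x : Fin 3 → X) z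
    have hw : ∀ z, (∀ i, u i ≠ z) → z ≠ x → (w z).Injective := by
      intro z hz hzx
      refine Fin.snoc_injective_iff.2 ⟨Fin.snoc_injective_iff.2 ⟨hu, ?_⟩, ?_⟩
      · rintro ⟨i, hi⟩; exact hux i hi
      · rintro ⟨i, hi⟩
        revert hi
        refine Fin.lastCases ?_ (fun i => ?_) i
        · rw [Fin.snoc_last]; exact fun h => hzx h.symm
        · rw [Fin.snoc_castSucc]; exact hz i
    obtain ⟨h, hh⟩ := t4 (w (n • x)) (w y) (hw _ hunx hx) (hw _ huy hyx)
    have hhu : ∀ i, h • u i = u i := fun i => by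
      have := hh i.castSucc.castSucc
      simpa only [w, Fin.snoc_castSucc] using this
    have hhx : h • x = x := by
      have := hh (Fin.last 2).castSucc
      simpa only [w, Fin.snoc_castSucc, Fin.snoc_last] using this
    have hhy : h • n • x = y := by
      have := hh (Fin.last 3)
      simpa only [w, Fin.snoc_last] using this
    let h' : S := ⟨h, hhu⟩
    refine ⟨⟨h' * n * h'⁻¹, (inferInstance : N.Normal).conj_mem _ n.2 h'⟩, ?_⟩
    change (h * (n : S) * h⁻¹) • x = y
    rw [mul_smul, mul_smul, inv_smul_eq_iff.2 hhx.symm]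
    exact hhy
  have ho : MulAction.orbit N x = ((Finset.univ \ Finset.univ.image u : Finset X) : Set X) := by
    ext y
    simp only [Finset.coe_sdiff, Finset.coe_univ, Finset.coe_image, Set.image_univ, Set.mem_sdiff,
      Set.mem_univ, true_and, Set.mem_range, not_exists]
    refine ⟨?_, fun h => ?_⟩
    · rintro ⟨m, rfl⟩ i h
      exact hux i (MulAction.injective m (show m • u i = m • x from ((m : S).2 i).trans h))
    · by_cases hyx : y = x
      · rw [hyx]; exact MulAction.mem_orbit_self x
      · exact key y h hyx
  have hd : (MulAction.orbit N x).ncard ∣ Nat.card N := by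
    rw [← MulAction.index_stabilizer]; exact Subgroup.index_dvd_card _
  rw [ho, Set.ncard_coe_finset, Finset.card_sdiff_of_subset (Finset.subset_univ _), hNc,
    Finset.card_image_of_injective _ hu, Finset.card_univ, hX, Finset.card_univ,
    Fintype.card_fin] at hd
  norm_num at hd

/-- A permutation group of degree twelve and order at most `95040` that contains elements with the
listed cycle types has order `95040`. -/
theorem card_eq_95040 [FaithfulSMul G X] (hX : Fintype.card X = 12) (hG : Nat.card G ≤ 95040)
    (h02 : HasCycles G X 0 2)
    (h11 : HasCycles G X 1 11) (h25 : HasCycles G X 2 5) (h22 : HasCycles G X 2 2)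
    (h33 : HasCycles G X 3 3) (h44 : HasCycles G X 4 4)
    (h8 : ∃ g : G, ∃ F : Finset X, F.card = 2 ∧ (∀ x ∈ F, g • x = x) ∧
      ∃ x : X, 8 ∣ Function.minimalPeriod (g • ·) x) :
    Nat.card G = 95040 := by
  classical
  obtain ⟨-, t2, -, t4⟩ := tupleTransitive_four hX h02 h11 h25 h22 h33 h44
  obtain ⟨v⟩ : Nonempty (Fin 4 ↪ X) := Function.Embedding.nonempty_of_card_le (by simp [hX])
  obtain ⟨g, hg, F, hF, -, -, hn⟩ := h44.exists_of_tupleTransitive t4 le_rfl v v.injective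
  obtain ⟨x, hx⟩ : ∃ x, x ∉ F := by
    by_contra! h
    have := Finset.card_eq_of_equiv_fintype (s := F) (Equiv.subtypeUnivEquiv h)
    lia
  obtain ⟨a, ha⟩ := dvd_card_tupleStabilizer v g hg x (hn x hx)
  have h4 := ha.trans (orderOf_dvd_natCard a)
  have hc := t4.card_eq v v.injective
  have h0 : 0 < Nat.card (tupleStabilizer G (v : Fin 4 → X)) := Nat.card_pos
  have hne := card_ne_of_tupleTransitive hX t2 t4 h8
  rw [hX] at hc
  norm_num [Nat.descFactorial] at hc
  lia

end MultiplyTransitive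

/-! ### Verifying integral polynomial identities in two variables by Kronecker substitution -/

section Kronecker

/-- Integral polynomial expressions in two variables `m` and `r`. -/
inductive BiExpr
  | const (z : ℤ)
  | m
  | r
  | add (a b : BiExpr)
  | mul (a b : BiExpr)
  | neg (a : BiExpr)

namespace BiExpr

/-- The value of an expression in a commutative ring. -/
def eval {R : Type*} [CommRing R] (m r : R) : BiExpr → R
  | const z => z
  | BiExpr.m => m
  | BiExpr.r => r
  | add a b => eval m r a + eval m r b
  | mul a b => eval m r a * eval m r b
  | neg a => -eval m r a

/-- The value of the expression with all signs made positive. -/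
def majorant {R : Type*} [CommSemiring R] (m r : R) : BiExpr → R
  | const z => (z.natAbs : R)
  | BiExpr.m => m
  | BiExpr.r => r
  | add a b => majorant m r a + majorant m r b
  | mul a b => majorant m r a * majorant m r b
  | neg a => majorant m r a

/-- The value of the sign-free expression at natural numbers. -/
def majorantNat (m r : ℕ) : BiExpr → ℕ
  | const z => z.natAbs
  | BiExpr.m => m
  | BiExpr.r => r
  | add a b => Nat.add (majorantNat m r a) (majorantNat m r b)
  | mul a b => Nat.mul (majorantNat m r a) (majorantNat m r b)
  | neg a => majorantNat m r a

/-- A natural number congruent to the value of the expression modulo `M`. -/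
def evalMod (M m r : ℕ) : BiExpr → ℕ
  | const (.ofNat z) => z
  | const (.negSucc z) => Nat.sub M (Nat.mod (Nat.succ z) M)
  | BiExpr.m => m
  | BiExpr.r => r
  | add a b => Nat.mod (Nat.add (evalMod M m r a) (evalMod M m r b)) M
  | mul a b => Nat.mod (Nat.mul (evalMod M m r a) (evalMod M m r b)) M
  | neg a => Nat.sub M (Nat.mod (evalMod M m r a) M)

theorem majorantNat_eq (m r : ℕ) (e : BiExpr) : e.majorantNat m r = e.majorant m r := by
  induction e with
  | const z => simp [majorantNat, majorant]
  | m => rfl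
  | r => rfl
  | add a b ha hb => exact congrArg₂ (· + ·) ha hb
  | mul a b ha hb => exact congrArg₂ (· * ·) ha hb
  | neg a ha => exact ha

theorem evalMod_cast {M : ℕ} (hM : 0 < M) (m r : ℕ) (e : BiExpr) :
    (e.evalMod M m r : ZMod M) = e.eval (m : ZMod M) (r : ZMod M) := by
  have hsub : ∀ x : ℕ, ((M - x % M : ℕ) : ZMod M) = -x := fun x => by
    rw [Nat.cast_sub (Nat.mod_lt _ hM).le, ZMod.natCast_self, zero_sub, ZMod.natCast_mod]
  induction e with
  | const z =>
    cases z with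
    | ofNat z => simp [evalMod, eval]
    | negSucc z => exact (hsub _).trans (Int.cast_negSucc z).symm
  | m => rfl
  | r => rfl
  | add a b ha hb =>
    rw [eval, ← ha, ← hb, ← Nat.cast_add, ← ZMod.natCast_mod (evalMod M m r a + _)]; rfl
  | mul a b ha hb =>
    rw [eval, ← ha, ← hb, ← Nat.cast_mul, ← ZMod.natCast_mod (evalMod M m r a * _)]; rfl
  | neg a ha => rw [eval, ← ha]; exact hsub _

theorem map_eval {R S : Type*} [CommRing R] [CommRing S] (f : R →+* S) (m r : R) (e : BiExpr) :
    f (e.eval m r) = e.eval (f m) (f r) := by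
  induction e <;> simp_all [eval]

theorem map_majorant {R S : Type*} [CommSemiring R] [CommSemiring S] (f : R →+* S) (m r : R)
    (e : BiExpr) : f (e.majorant m r) = e.majorant (f m) (f r) := by
  induction e <;> simp_all [majorant]

/-- The expression as a polynomial in `r` whose coefficients are polynomials in `m`. -/
noncomputable def toPoly (e : BiExpr) : ℤ[X][X] := e.eval (C X) X

/-- The sign-free expression as a polynomial. -/
noncomputable def toMajorant (e : BiExpr) : ℕ[X][X] := e.majorant (C X) X

theorem abs_coeff_toPoly_le (e : BiExpr) (i j : ℕ) :
    |(e.toPoly.coeff j).coeff i| ≤ ((e.toMajorant.coeff j).coeff i : ℤ) := by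
  induction e generalizing i j with
  | const z =>
    have h1 : (const z).toPoly = C (C z) := by simp [toPoly, eval]
    have h2 : (const z).toMajorant = C (C z.natAbs) := by simp [toMajorant, majorant]
    rw [h1, h2, coeff_C, coeff_C]
    split_ifs
    · rw [coeff_C, coeff_C]; split_ifs <;> simp
    · simp
  | m =>
    have h1 : BiExpr.m.toPoly = C X := rfl
    have h2 : BiExpr.m.toMajorant = C X := rfl
    rw [h1, h2, coeff_C, coeff_C]
    split_ifs
    · rw [coeff_X, coeff_X]; split_ifs <;> simp
    · simp
  | r =>
    have h1 : BiExpr.r.toPoly = X := rfl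
    have h2 : BiExpr.r.toMajorant = X := rfl
    rw [h1, h2, coeff_X, coeff_X]
    split_ifs
    · rw [coeff_one, coeff_one]; split_ifs <;> simp
    · simp
  | add a b ha hb =>
    have h1 : (add a b).toPoly = a.toPoly + b.toPoly := rfl
    have h2 : (add a b).toMajorant = a.toMajorant + b.toMajorant := rfl
    rw [h1, h2]
    simp only [coeff_add, Nat.cast_add]
    exact (abs_add_le _ _).trans (add_le_add (ha i j) (hb i j))
  | mul a b ha hb =>
    have h1 : (mul a b).toPoly = a.toPoly * b.toPoly := rfl
    have h2 : (mul a b).toMajorant = a.toMajorant * b.toMajorant := rfl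
    rw [h1, h2]
    simp only [coeff_mul, finsetSum_coeff, Nat.cast_sum, Nat.cast_mul]
    refine (Finset.abs_sum_le_sum_abs _ _).trans (Finset.sum_le_sum fun x _ => ?_)
    refine (Finset.abs_sum_le_sum_abs _ _).trans (Finset.sum_le_sum fun y _ => ?_)
    rw [abs_mul]
    exact mul_le_mul (ha _ _) (hb _ _) (abs_nonneg _) (Nat.cast_nonneg _)
  | neg a ha =>
    have h1 : (neg a).toPoly = -a.toPoly := rfl
    have h2 : (neg a).toMajorant = a.toMajorant := rfl
    rw [h1, h2, coeff_neg, coeff_neg, abs_neg]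
    exact ha i j

theorem _root_.Polynomial.eq_zero_of_eval_eq_zero_of_abs_coeff_lt {p : ℤ[X]} {B : ℤ}
    (h : p.eval B = 0) (hB : ∀ i, |p.coeff i| < B) : p = 0 := by
  have key : ∀ n, ∀ p : ℤ[X], p.natDegree ≤ n → p.eval B = 0 → (∀ i, |p.coeff i| < B) → p = 0 := by
    have h0 : ∀ p : ℤ[X], p.eval B = 0 → (∀ i, |p.coeff i| < B) → p.coeff 0 = 0 := by
      intro p h hB
      rw [← divX_mul_X_add p] at h
      simp only [eval_add, eval_mul, eval_X, eval_C] at h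
      exact Int.eq_zero_of_abs_lt_dvd ⟨-p.divX.eval B, by linarith⟩ (hB 0)
    intro n
    induction n with
    | zero =>
      intro p hp h hB
      rw [eq_C_of_natDegree_le_zero hp, h0 p h hB, C_0]
    | succ n ih =>
      intro p hp h hB
      have hp0 := h0 p h hB
      have hpos : 0 < B := (abs_nonneg _).trans_lt (hB 0)
      have hd := divX_mul_X_add p
      rw [hp0, C_0, add_zero] at hd
      rw [← hd, ih p.divX, zero_mul]
      · rw [natDegree_divX_eq_natDegree_tsub_one]; lia
      · rw [← hd, eval_mul, eval_X] at h
        exact (mul_eq_zero.1 h).resolve_right hpos.ne'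
      · intro i
        rw [coeff_divX]
        exact hB _
  exact key _ p le_rfl h hB

theorem _root_.Polynomial.abs_eval_le_of_abs_coeff_le {p : ℤ[X]} {q : ℕ[X]}
    (h : ∀ i, |p.coeff i| ≤ (q.coeff i : ℤ)) (B : ℕ) : |p.eval (B : ℤ)| ≤ (q.eval B : ℕ) := by
  rw [eval_eq_sum_range' (n := p.natDegree + q.natDegree + 1) (by lia),
    eval_eq_sum_range' (n := p.natDegree + q.natDegree + 1) (p := q) (by lia)]
  push_cast
  refine (Finset.abs_sum_le_sum_abs _ _).trans (Finset.sum_le_sum fun i _ => ?_)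
  rw [abs_mul, abs_of_nonneg (show (0 : ℤ) ≤ (B : ℤ) ^ i by positivity)]
  exact mul_le_mul_of_nonneg_right (h i) (by positivity)

theorem _root_.Polynomial.coeff_le_eval_of_pos (q : ℕ[X]) {B : ℕ} (hB : 0 < B) (i : ℕ) :
    q.coeff i ≤ q.eval B := by
  by_cases hi : i ≤ q.natDegree
  · rw [eval_eq_sum_range]
    calc q.coeff i ≤ q.coeff i * B ^ i := Nat.le_mul_of_pos_right _ (by positivity)
      _ ≤ _ := Finset.single_le_sum (f := fun i => q.coeff i * B ^ i) (fun _ _ => Nat.zero_le _)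
        (Finset.mem_range.2 (by lia))
  · rw [coeff_eq_zero_of_natDegree_lt (by lia)]; exact Nat.zero_le _

/-- The numerical conditions that ensure the vanishing of an expression. -/
def IsZeroAt (B c M : ℕ) (e : BiExpr) : Bool :=
  Nat.blt 0 B && Nat.blt 0 c && Nat.blt (e.majorantNat 1 1) B && Nat.blt (e.majorantNat B 1) c &&
    Nat.blt (e.majorantNat B c) M && Nat.beq (Nat.mod (e.evalMod M B c) M) 0

theorem eval_eq_zero_of_isZeroAt {B c M : ℕ} {e : BiExpr} (h : e.IsZeroAt B c M = true)
    {R : Type*} [CommRing R] (m r : R) : e.eval m r = 0 := by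
  simp only [IsZeroAt, Bool.and_eq_true, Nat.blt_eq, Nat.beq_eq] at h
  obtain ⟨⟨⟨⟨⟨hB, hc⟩, h1⟩, h2⟩, h3⟩, h4⟩ := h
  have hmaj : ∀ a b : ℕ, (e.toMajorant.eval (C b)).eval a = e.majorantNat a b := by
    intro a b
    have := map_majorant ((evalRingHom a).comp (evalRingHom (C b))) (C X) X e
    simpa [majorantNat_eq, toMajorant] using this
  have hval : ∀ a b : ℤ, (e.toPoly.eval (C b)).eval a = e.eval a b := by
    intro a b
    have := map_eval ((evalRingHom a).comp (evalRingHom (C b))) (C X) X e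
    simpa [toPoly] using this
  -- the polynomial in `r` obtained by substituting `B` for `m`
  set p : ℤ[X] := e.toPoly.map (evalRingHom (B : ℤ)) with hp
  set q : ℕ[X] := e.toMajorant.map (evalRingHom B) with hq
  have hpq : ∀ j, |p.coeff j| ≤ (q.coeff j : ℤ) := by
    intro j
    rw [hp, hq, coeff_map, coeff_map]
    exact abs_eval_le_of_abs_coeff_le (fun i => abs_coeff_toPoly_le e i j) B
  have hqe : ∀ b : ℕ, q.eval b = e.majorantNat B b := by
    intro b
    rw [← hmaj, hq, eval_map, ← coe_evalRingHom (r := B), ← eval₂_at_apply]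
    simp
  have hpe : ∀ b : ℤ, p.eval b = e.eval (B : ℤ) b := by
    intro b
    rw [← hval, hp, eval_map, ← coe_evalRingHom (r := (B : ℤ)), ← eval₂_at_apply]
    simp
  have hz : p.eval (c : ℤ) = 0 := by
    refine Int.eq_zero_of_abs_lt_dvd (m := M) ?_
      ((abs_eval_le_of_abs_coeff_le hpq c).trans_lt (by rw [hqe]; exact_mod_cast h3))
    rw [hpe, ← ZMod.intCast_zmod_eq_zero_iff_dvd]
    have := map_eval (Int.castRingHom (ZMod M)) (B : ℤ) (c : ℤ) e
    rw [eq_intCast] at this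
    rw [this, map_natCast, map_natCast, ← evalMod_cast (by lia)]
    exact (ZMod.natCast_eq_zero_iff _ _).2 (Nat.dvd_of_mod_eq_zero h4)
  have hp0 : p = 0 := by
    refine eq_zero_of_eval_eq_zero_of_abs_coeff_lt hz fun j => ?_
    refine (hpq j).trans_lt ?_
    have := coeff_le_eval_of_pos q Nat.one_pos j
    rw [hqe] at this
    exact_mod_cast this.trans_lt h2
  have he : e.toPoly = 0 := by
    ext1 j
    rw [coeff_zero]
    refine eq_zero_of_eval_eq_zero_of_abs_coeff_lt (B := B) ?_ fun i => ?_
    · simpa [hp, coeff_map] using congrArg (fun f => f.coeff j) hp0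
    · refine (abs_coeff_toPoly_le e i j).trans_lt ?_
      have h5 := coeff_le_eval_of_pos (e.toMajorant.coeff j) Nat.one_pos i
      have h6 := coeff_le_eval_of_pos (e.toMajorant.map (evalRingHom 1)) Nat.one_pos j
      rw [coeff_map, coe_evalRingHom] at h6
      have h7 : (e.toMajorant.map (evalRingHom 1)).eval 1 = e.majorantNat 1 1 := by
        rw [← hmaj, eval_map, ← coe_evalRingHom (r := 1), ← eval₂_at_apply]
        simp
      rw [h7] at h6
      exact_mod_cast (h5.trans h6).trans_lt h1
  have := map_eval (eval₂RingHom (eval₂RingHom (Int.castRingHom R) m) r) (C X) X e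
  rw [← toPoly, he, map_zero] at this
  simpa using this.symm

end BiExpr
end Kronecker

/-! ### The polynomial identity relating the two sets of roots -/

section Identity

namespace BiExpr

/-- The polynomial in `m` with the given coefficients. -/
def ofCoeffs : List ℤ → BiExpr
  | [] => const 0
  | a :: l => add (const a) (mul m (ofCoeffs l))

/-- The expression `1 + m ^ 2`. -/
def kappa : BiExpr := add (const 1) (mul m m)

/-- Powers of an expression. -/
def pow (a : BiExpr) : ℕ → BiExpr
  | 0 => const 1
  | n + 1 => mul (pow a n) a

/-- The polynomial in `r` whose coefficients are a power of `kappa` times a polynomial in `m`. -/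
def ofRows : List (ℕ × List ℤ) → BiExpr
  | [] => const 0
  | (e, p) :: l => add (mul (pow kappa e) (ofCoeffs p)) (mul r (ofRows l))

/-- The plane curve whose points correspond to pairs of roots. -/
def curve : BiExpr := ofRows
  [(0, [6022814, 5506470, 12340532, 10584196, 6316758, 5076958, 0]), (0, [-253176, -3470535,
   -307032, -6928446, 217272, -3457863, 271128]), (1, [-73726, 321558, 148892, 216292, 219738,
   -107570, 0]), (1, [4488, -3156, -22440, -40, -22440, 3180, 4488]), (2, [-60, -240, 600, 480,
   -300, -48, 0]), (2, [0, 3, 0, -10, 0, 3, 0])]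

/-- The negative of the parameter `s`, scaled by the cube of `kappa`. -/
def paramNum : BiExpr := ofRows
  [(0, [6861886, -2025408, 6703518, -4194432, -7153374, -2169024, -6994942]), (0, [-11012940,
   -1179616, -41479296, -2351552, -60067544, -1171936, -39755104, 0, -10153916]), (0, [3470535,
   -398640, 13844268, -1881792, 20734602, -3109920, 13818732, -2169024, 3457863, -542256]), (0,
   [-214372, -296824, -646956, -1179616, -436424, -1761744, 425672, -1171936, 644652, -292984,
   215140]), (0, [1578, 26928, 1638, 98736, -9388, 125664, -22148, 53856, -17470, -8976, -4770,
   -8976]), (0, [96, -480, -192, -1440, -1632, -960, -2688, 960, -1632, 1440, -192, 480, 96]), (0,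
   [-1, 0, 6, 0, 29, 0, 36, 0, 9, 0, -10, 0, -5])]

/-- The common denominator of the coefficients of the sextics. -/
def normD : BiExpr := ofRows
  [(0, [-41358233434500, -22580184645594, 67487424305850, -37027867648338, 75363055523766]), (1,
   [60584353985151, -35165324255949, -6670241542053, -22521413636865]), (1, [-5055642649755,
   2336029977870, 33270714146160, 4096772155782, 32861487562515]), (2, [481161865383,
   2398138866675, -4718049745725, 269280027423]), (2, [59657515497, -214025568408, 191228238126,
   -19555782696, -721070667])]

/-- A coefficient of the first sextic attached to a pair of roots. -/
def evenCoeff2 : BiExpr := ofRows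
  [(0, [636615412213692456, -2340074385511319772, -1327475677522375836, -4851001661065947576,
   -4420076235652494576, -2510811694090605852, -2455717285098693612]), (1, [1271883091107632202,
   810332595801814050, 4068287521075596420, 1652577585173887284, 2798709466924085850,
   823149934242537906]), (1, [-102890845827602082, -696729241001881908, -228087922181647986,
   -1513014608039404500, -20908649245937346, -816073722869343984, 104728032513461214]), (2,
   [-16603225275424374, 84279280574034450, 14208590080568214, 70281097639488126,
   31160100497386932, -22050403995050316]), (2, [1377595052810838, -2049963335331480,
   -3761081095263768, -202795940030220, -4921334661110238, 1912369007382300, 330090925196160]),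
   (3, [-25683068208960, -34294118611104, 188556352334946, -25263869177718, -27205650910422,
   -16609184622]), (3, [0, 1284153410448, -2339077597362, 117334696176, 357464379204, 0,
   1442141334])]

/-- A coefficient of the first sextic attached to a pair of roots. -/
def evenCoeff3 : BiExpr := ofRows
  [(0, [5536202802287215879152, 5664300319893578493744, 11893365936578803439376,
   10962770776531102891872, 6863821908706764770832, 5297699065593676155696,
   507464930776589386992]), (0, [-256617565883264537388, -3232900149057019482588,
   -696820581227276755776, -6453244299119443606692, -556917394950824608476,
   -3212589202538390915796, -116710695055165133448, 7711876994987229300]), (1,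
   [-67492089939147121980, 299559969992986847100, 165684421975502350980, 236551334765048901000,
   218508155175013823916, -65358167146237587060, -12258323400268208340]), (1,
   [4445560324625571684, -3150072135985599540, -20607998964394609944, -3299358161666387340,
   -21191428908510717060, 561434253168925980, 3867572422635483096, 653001547404413844]), (2,
   [-58796517105361404, -275772642315822360, 566714247942327336, 447573310121212740,
   -183463633487272176, -62082799588930644, -7469118492595236]), (2, [-1136895250655088,
   5683089006887544, 1995516419825592, -8770286470616712, 1709248021282440, 0, 0, 299965397472]),
   (3, [28029762132480, 30676465839852, -216166334754636, 43647519562524, 53159957343108, 0, 0]),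
   (3, [0, -1401488106624, 1978248221712, 1557934368192, -1495219532400, 0, 0, 0])]

/-- A coefficient of the first sextic attached to a pair of roots. -/
def evenCoeff4 : BiExpr := ofRows
  [(0, [22858613394204369136644, 23567785580983550189994, 72097071120915758016246,
   69181704685716802819830, 77831371745355570229170, 67656851651622024080046,
   30809260236710195917650, 22042932084562915362402, 2216345146622743637394]), (1,
   [11609346992407392708963, -599793367190703115905, 23948824501584457946739,
   -2040272193047422702887, 12638409487359424385229, -1451839823164136903355,
   300826317318870342429, -9699100611603302997]), (1, [-771699712863376350171,
   -6093076625573584954248, -796941193529811638196, -12310944350187335486940,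
   791127209519036965836, -6364859715718601499504, 741655476085807626552, -147094218309799728540,
   -74724194588920661133]), (2, [-139286966175460877769, 628599537656567006355,
   298975488654726593775, 430489680349372946325, 436594685380465266657, -193747588247253209895,
   3993764120607658473, 9595580019253258743]), (2, [8861105030936406057, -3848585571644532462,
   -46730786922838135242, 487135826676657594, -46113743922393725514, 3292186942531203246,
   9420528952175756670, -1179372448051236090, -71075072116536075]), (3, [-79997849264083104,
   -654655871500040844, 1144649769897202200, 1108807287678671850, -659987936858916072, 0, 0,
   612962639630154]), (3, [-2016278279410608, 8599017042556128, 8241612790964652,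
   -25344220129558560, 6947451514231794, 0, 0, 0, -14284802088054]), (4, [26465299516800,
   67785194952108, -302444478063792, 113590316538090, 28372847216400, 0, 0, 18002207394]), (4, [0,
   -1323264975840, 2224569704148, 441088325280, -754502506722, 0, 0, 0, 1442141334])]

/-- A coefficient of the first sextic attached to a pair of roots. -/
def evenCoeff5 : BiExpr := ofRows
  [(0, [56830476625379460327319848, -47794699176228226962486288, 16736652145665396251915760,
   -114537824223800492196177840, -135173666756334138839239968, -76257147643063874448928560,
   -96945504967973655589872240, -9521233865510827487816592, -1888511272871101114130568]), (0,
   [-3853295690446775128656204, -29919429474604062002260920, 50454499073250630111775560,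
   -59285782745381270058978276, 113927488405867313155435104, -30211944621453707024787516,
   60502662940979722252339512, -945876236109570490653036, 883746436394649451638636,
   -99764165685342229879644]), (1, [-650203373125396115433540, 5066567517383047359285048,
   -3776669391309997194468000, 767389100771423262719088, -1910190728215450423763568,
   -4208243056451167523893128, 1325090676359655047666736, 69308015333246144095680,
   40270088545809199558596]), (1, [60863377703497637357124, -171995378040914221670256,
   -173765546169057172713240, 261677279286247686818148, -248584690945840115223072,
   389316571615723534157772, -21876647174158935284712, -46716618938178540227220,
   -6884542362674608535844, -1666377449491984589196]), (2, [-1454319630152658251316,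
   -1075199858731779678432, 13714642177194700247688, -5812221228740630578728,
   -7431996903276201986520, 2604327027471199917936, 262679560169267301192, 129835391119706294712,
   16139427514754890716]), (2, [3993413228412438240, 71151530211490175856, -105543845412188434848,
   -102235774405771074528, 149714332983223642368, 0, 0, 0, 0, 3025902446670384]), (3,
   [7740510108463872, 518326317390556944, -530770707265368816, -865974163391961264,
   -199205146622219040, 0, 0, 0, 10780788378096]), (3, [5207334064870464, -10477724012297856,
   -35112058845312096, 35212666219691040, 11126841511212000, 0, 0, 0, 0, -299965397472]), (4,
   [-59188449496320, -203231880236880, 676994112120528, 79294021876080, -322064064187632, 0, 0, 0,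
   0]), (4, [0, 2959422474816, -3473467754112, -5349560822208, 4501036418688, 0, 0, 0, 0, 0])]

/-- A coefficient of the first sextic attached to a pair of roots. -/
def evenCoeff6 : BiExpr := ofRows
  [(0, [-4652583850314814150156646040, -4967952425651161318796217120,
   -14996495808838157035454814648, -14784608558714030245081763856, -16832139232644884276550118416,
   -14831990434001612860716222000, -7313250564133039284562556112, -5182646684603895277156629552,
   -852517902918602068741031640, -167312383664226691013778672, -27494612904961288888563960]), (1,
   [194563592354489038428073728, 2632090511821869410738124360, 574623628827826904368953456,
   5310964885145876390202219936, 525712343747592351828081804, 2729540114353484301467424048,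
   155706401997438349708014216, 49122372820915853799919776, 10048803857362332107740332,
   -1567827885996194725908792]), (1, [55910487974479085918741352, -236773874001835337967989994,
   -52259566192424631016597968, -425820960231184687215245952, -264544262774559004223371032,
   -138577905251916705566118996, -149898786899674006274763864, 52088615432656975403653008,
   7049067282668177325859440, 1619484266936116258538958, 573037638782382050494824]), (2,
   [-3418763049837078407498571, 3404169087298964546613249, 13501782978374403760203570,
   1606422560570296322893788, 14734376711717223377127621, -2218404258418310780422800,
   -2269960610580649918948656, -429997541683124183606280, -108718503017228818035624,
   -23020553640189891992157]), (2, [59181750683966590411251, 83055508132749635185218,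
   -350028244727635327087197, -34700950796090407228656, -284748484893792649809249,
   -96101226919646692940076, 129041396341790563188504, 23300152543072119479424,
   5636811362793472613952, 1711247023469259869562, 246205959586843930983]), (3,
   [-673678482546511079181, -1162238701654745065305, 5541456048396864725718,
   -585826493261858564556, -2698782536144213029389, 0, 0, 0, 0, -1536915322551448467]), (3,
   [4698838412888684265, 27563991983049299040, -88726257553547828997, 11076012079527940320,
   109442647100087968629, 0, 0, 0, 0, 0, 43799032702958355]), (4, [170534145915,
   237857672950444503, 47149841241861678, -917540135774795508, -415112754005960733, 0, 0, 0, 0,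
   -777812850132939]), (4, [2500904293878069, -3387609841864320, -27909347102643915,
   25355082282894720, 13812883545349881, 0, 0, 0, 0, 0, 5611404954537]), (5, [-18170139999591,
   -144252914596443, 359015285410146, 107122350569868, -230833122921351, 0, 0, 0, 0,
   42915984327]), (5, [-59657515497, 1384830549504, -1137516469443, -3370334625792, 2634078899979,
   0, 0, 0, 0, 0, -721070667])]

/-- A coefficient of the second sextic attached to a pair of roots. -/
def oddCoeff1 : BiExpr := ofRows
  [(0, [1289608684867446912, -4671207017902984320, -2665298514629806272, -9678398533423498080,
   -8896721261317517088, -5006960352592469856, -4941278340184798560]), (1, [2519774778037144608,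
   1634590660008983904, 8115225053623726032, 3327999118553328912, 5600060349498824688,
   1655218348285274352]), (1, [-203779657165901184, -1394383549875000336, -467349012675872352,
   -3028576605723735192, -68005650368509992, -1633769767512377640, 196442915952166488]), (2,
   [-33396990649540416, 167608898156865600, 30094987761751860, 139505897396913444,
   64188548694080964, -44207442880960140]), (2, [2731565729484864, -4015172545573392,
   -7621512948962244, -313093665023256, -9918110160534240, 3832482104712216, 660467394376452]),
   (3, [-51366136417920, -68588237222208, 377112704669892, -50527738355436, -54411301820844,
   -33218369244]), (3, [0, 2568306820896, -4678155194724, 234669392352, 714928758408, 0,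
   2884282668])]

/-- A coefficient of the second sextic attached to a pair of roots. -/
def oddCoeff2 : BiExpr := ofRows
  [(0, [5535640495745440417152, 5663993319703136997720, 11893721189057890313976,
   10961960345452114592400, 6865764103830528229968, 5297195634705129352248,
   508489566879490509528]), (0, [-255793861006482424392, -3233378256805603365192,
   -695263860077718282372, -6454506715756418188440, -556275067282054000656,
   -3213679712566588431480, -116801383659170886036, 7405675855180412760]), (1,
   [-67560826456613190960, 299591730656565967620, 166068034087567473360, 236638795142858033592,
   219407288589444969216, -65302467432007574988, -11811538615368254400]), (1,
   [4452102201347318952, -3117467039954286240, -20659061815293992508, -3230486838350917632,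
   -21313180240474723992, 601361611705925496, 3803425818292605996, 656662678657256952]), (2,
   [-57985413524664192, -278682533943897528, 570125290648585644, 444397538071602756,
   -180873498038499612, -62348680010465460, -7478922169383768]), (2, [-1136895250655088,
   5683089006887544, 1995516419825592, -8770286470616712, 1709248021282440, 0, 0, 299965397472]),
   (3, [28029762132480, 30676465839852, -216166334754636, 43647519562524, 53159957343108, 0, 0]),
   (3, [0, -1401488106624, 1978248221712, 1557934368192, -1495219532400, 0, 0, 0])]

/-- A coefficient of the second sextic attached to a pair of roots. -/
def oddCoeff3 : BiExpr := ofRows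
  [(0, [844569548970114100971744, 693921433851741253932792, 2503506218171663754296856,
   2017813802733495958560264, 2407198546941278483308968, 1953769215113161495288488,
   682300609529248695817224, 629876845306755078485400, -65961270353366676028008]), (1,
   [-10140422333471908600896, -444375784467917086976568, 63751710864331610573580,
   -894865364815361560971840, 165225655231109044677432, -457945698502504549693944,
   91335636177556991317164, -7456379182046992632816]), (1, [-11036758541071439054736,
   30970249208434839875256, -2860826380238018976588, 47717808696853214211936,
   28404196666807937447376, 2366158449726343919736, 21286457687450899646820,
   -14381641590300281727792, 1058063194324055656728]), (2, [298498284637916305248,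
   459074751681542503824, -1516340423275632354564, 937802703702202685748, -1582496485664195398392,
   488863009745925023592, 239774095400990736492, 20275465929498936900]), (2, [6455504733953939568,
   -9698661767368897488, -35148990840549374844, 9670819443918788808, -39578265874783899828,
   16811893267971545520, 1698503070197541852, -2876789634636086568, -497650309092720540]), (3,
   [110175335259292800, -1598782170944634192, 1070963378146980648, 2516334825432203388,
   -1584461530841711544, 0, 0, -1285391564865324]), (3, [-10310569628347296, 14401796106786192,
   59564358562783752, -65296383042326832, 27562473326364516, 0, 0, 0, -2970284556348]), (4,
   [102732272835840, 361106222845896, -1199883661183368, 174796732349352, 169471490509656, 0, 0,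
   138445568064]), (4, [0, -5136613641792, 9362078954784, -469338784704, -1449086067936, 0, 0, 0,
   0])]

/-- A coefficient of the second sextic attached to a pair of roots. -/
def oddCoeff4 : BiExpr := ofRows
  [(0, [98138353154431114139500440, -63335503738921372112212560, 32405758051380191375073264,
   -170636045914501043499435024, -227870621941074796521177408, -134884381174708007024698032,
   -164804644024210653231853296, -27591545401247633764984560, -2705948961040240104744792]), (0,
   [-6953571740365180120086624, -52876021383908969260047588, 75684544719231885676403940,
   -96426010184419141527802284, 173897617519296204690962772, -36366673275077187940915284,
   91727030796067908212498748, 7090970052409163220054924, 468723999234685983612588,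
   -91334294573881407771240]), (1, [-1138577242831719296300496, 8660491731525833336208384,
   -5301288207991730671298676, 1297306557866649013100100, -2825389190839361367583944,
   -6984620884769843466948600, 1517250523637632774303692, 355454124227435457636228,
   61938766090968155866800]), (1, [109862404398185768736048, -280334424688239491982180,
   -327597883312751662882716, 397133869979455191781452, -402348184977965877820620,
   608539336571548202956452, 15064198362218955803868, -73438860917534234511564,
   -18455228806892455282212, -3162121993724061272256]), (2, [-2371497182622728935200,
   -3405846509644641525720, 23300357447774305225188, -8324354464797128233716,
   -13054458371403962065320, 3062492273517553077264, 628214831053090181460, 263953081338061688748,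
   36460550506826422656]), (2, [-10590938245447398720, 138650664767708189016,
   -84635525261704831200, -197792024848475126976, 324474508387646442720, 0, 0, 0, 0,
   8533022871599208]), (3, [150922154651427072, 2382203395751079024, -3365349649666996320,
   -3693814623752567760, 890893916910330408, 0, 0, 0, 8754701475384]), (3, [14829785172499968,
   -37021875294808800, -86240316519981504, 114880832933263488, 6700428298728000, 0, 0, 0, 0,
   -899896192416]), (4, [-171307498026240, -552191065705728, 1919405521013760, 39503358892800,
   -732697399560960, 0, 0, 0, 0]), (4, [0, 8565374901312, -11386460640960, -11581298294976,
   10481914548288, 0, 0, 0, 0, 0])]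

/-- A coefficient of the second sextic attached to a pair of roots. -/
def oddCoeff5 : BiExpr := ofRows
  [(0, [-13148415099836307458498405376, -13281105857027817969981413280,
   -42171600350556465632481004992, -39859421942672830699597036512, -46970458772014291041357208416,
   -40699742725384970050015083360, -20054918601057791887335226656, -14947395528792480397041278880,
   -2140994954425610134386257184, -825968889048824469793116288, -33349874653379568258193824]), (1,
   [495140876349398085980527152, 7333528017322050537895261872, 1085527190880170762093119536,
   15104472776960733057272980464, 525715379038473735134860176, 8226583631803423629508720944,
   -94915076065285795180441584, 455055564892160991646810512, -30256099613031228527850624,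
   -638289460392343518312288]), (1, [159429442584187695159280944, -646250043932215711645367448,
   -88202537634287834883783144, -1163535106027476106475234424, -655710335203743922175858232,
   -372119195107510258235180472, -412641998831431779915293568, 158736401012134954583825688,
   -3767146396010252329175784, 13570161245038971587537136, 794676168092559169115640]), (2,
   [-8977754874535296876412896, 7981615202094307559839704, 34404179583295529139473664,
   1225701826172833011121440, 39675446087587571203261536, -8158502539571294584745376,
   -4099633808916381660544128, -1454122292884618091796864, -445234499949916263548160,
   -54202680729285210910872]), (2, [137703838340154375447480, 200614661032903611240888,
   -759461756897643869798568, -1911079831207968936840, -633108772527221177928048,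
   -162147263709294560035656, 285072446553248377708128, 45606131760506789617128,
   24192820159796643343704, 4730106591013920151536, 748302862977141676776]), (3,
   [-1714716852084064748736, -814200529644284581476, 12082323476340237674304,
   -10765787961472502031216, -4645183348005864452352, 0, 0, 0, 0, -3523134404717508492]), (3,
   [8550682960767050520, 52660948625964938304, -232209707129136318204, 177592190459083112256,
   367157040430864451784, 0, 0, 0, 0, 0, 148921107150055644]), (4, [-53326471940511264,
   2149283868176044152, -797380493709515616, -6099628204624089024, -41087301925187520, 0, 0, 0, 0,
   -3219121934931384]), (4, [14089074931991088, -24122686117240512, -126019667717283456,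
   143157199580596800, 27421798236692976, 0, 0, 0, 0, 0, 25482769467552]), (5, [-118376898992640,
   -589600834535628, 1730378756373408, 149608128480336, -790660285058016, 0, 0, 0, 0,
   171663937308]), (5, [0, 5918844949632, -6976098810756, -10699121644416, 9089669570256, 0, 0, 0,
   0, 0, -2884282668])]

/-- A coefficient of the second sextic attached to a pair of roots. -/
def oddCoeff6 : BiExpr := ofRows
  [(0, [-6461420138272832050093228945832, 7060753732237833505774784648280,
   -1719183104369957913550835374976, 15301191339860439903938317673024,
   15686578905651088688952865090032, 8375001259696291748452955464592,
   11280595172470359803187398820768, 143598703138780481935535190336,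
   342235785664023395848107364152, 7810372096570205139646791576, 3402735414398600027861634912]),
   (0, [408753624783733104720699466704, 3297457586536244094255010700532,
   -6712298507284889168080619393280, 7300961469743223724167261687744,
   -14938820095654419438848026422480, 4890802723270276215609686451816,
   -8061207762197276350652005062720, 906040469599864324605981141504,
   -245750823270759452534717172000, 18881656658134665483720086532, -2210766165664464115025268192,
   188807803045301890345846176]), (1, [72354501041035383648821723488,
   -581616181456338247981666150056, 532539321692331394819069024264,
   -92308996319962077399318451672, 256129867154483086534558981704, 503326594850297173892868503960,
   -218129265869225220291894874344, 17750451322192259791990308120, -6406239276920249984681503848,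
   57896232503271852128350032, -71572097512444010870444256]), (1, [-6436292957793205703293663344,
   20945794002919523771961941436, 17449781706334412467529383440, -34248510351959837155188504896,
   30891736965822454415341380192, -49862671292252672836938542664, 7293553246752585528970629504,
   5598465145477643831968043520, 161462652422138454671560272, 204604243747958406775439916,
   7263318778621234171004592, 2819631566629326581595360]), (2, [177747922724465929977928848,
   -30953030345561792679127128, -1588985186423031874378476360, 786718801897276386886486584,
   810231057655926099479479032, -419523030999278836025037240, -4883124156957223206883896,
   -13649389481605452442235640, -1011963326096332333816776, -223697413933752542630832,
   -24996356136249023429568]), (2, [-2288449114247335798378512, -5860265842525692636038208,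
   21501500048198535448344672, 10408742925605752834091152, -9647710098021647214336144, 0, 0, 0, 0,
   0, 0, -31903371133676352720]), (3, [22708536331076921279232, 72185808479166559226304,
   -218574687725985880705104, -113480499892213639655232, 123810942411934629959040, 0, 0, 0, 0, 0,
   447754515911883216]), (3, [-230259980023934042880, -851139946318774205376,
   2561509372389755014656, 1336645187934692952336, -1750188251004019397376, 0, 0, 0, 0, 0, 0,
   -1659053815825104]), (4, [1733810660792358912, 7140359326628384640, -19554677355514604112,
   -10172541499603749504, 15618818677109720256, 0, 0, 0, 0, 0, -32378296996080]), (4,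
   [-22761267970975488, -55288693818807552, 263159693255447424, 54705771455261472,
   -209667193105875840, 0, 0, 0, 0, 0, 0, 299965397472]), (5, [166179665940480, 1027888957824192,
   -2357094157564608, -1384817949182016, 1825510260787776, 0, 0, 0, 0, 0, 0]), (5, [0,
   -8308983297024, 7974504172800, 20222007754752, -16031023393536, 0, 0, 0, 0, 0, 0, 0])]

/-- The coefficients of the first sextic attached to a pair of roots. -/
def sexticEven : List BiExpr :=
  [evenCoeff6, mul kappa evenCoeff5, mul kappa evenCoeff4, mul (pow kappa 2) evenCoeff3,
    mul (pow kappa 2) evenCoeff2, const 0, mul (pow kappa 3) normD]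

/-- The coefficients of the second sextic (of degree five) attached to a pair of roots. -/
def sexticOdd : List BiExpr :=
  [oddCoeff6, oddCoeff5, mul kappa oddCoeff4, mul kappa oddCoeff3, mul (pow kappa 2) oddCoeff2,
    mul (pow kappa 2) oddCoeff1]

/-- The value at `x` of a polynomial with the given coefficients. -/
def evalX {R : Type*} [CommRing R] (m r x : R) : List BiExpr → R
  | [] => 0
  | a :: l => a.eval m r + x * evalX m r x l

/-- Sum of two coefficient lists. -/
def addX : List BiExpr → List BiExpr → List BiExpr
  | [], l => l
  | a :: k, [] => a :: k
  | a :: k, b :: l => add a b :: addX k l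

/-- Multiplication of a coefficient list by an expression. -/
def smulX (a : BiExpr) : List BiExpr → List BiExpr
  | [] => []
  | b :: l => mul a b :: smulX a l

/-- Product of two coefficient lists. -/
def mulX : List BiExpr → List BiExpr → List BiExpr
  | [], _ => []
  | a :: k, l => addX (smulX a l) (const 0 :: mulX k l)

section

variable {R : Type*} [CommRing R] (m r x : R)

theorem evalX_addX (k l : List BiExpr) :
    evalX m r x (addX k l) = evalX m r x k + evalX m r x l := by
  fun_induction addX k l <;> simp_all [evalX, eval] <;> ring

theorem evalX_smulX (a : BiExpr) (l : List BiExpr) :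
    evalX m r x (smulX a l) = a.eval m r * evalX m r x l := by
  induction l with
  | nil => simp [smulX, evalX]
  | cons b l ih => simp only [smulX, evalX, eval, ih]; ring

theorem evalX_mulX (k l : List BiExpr) :
    evalX m r x (mulX k l) = evalX m r x k * evalX m r x l := by
  induction k with
  | nil => simp [mulX, evalX]
  | cons a k ih =>
    simp only [mulX, evalX, evalX_addX, evalX_smulX, ih, eval, Int.cast_zero]; ring

theorem eval_pow (a : BiExpr) (n : ℕ) : (pow a n).eval m r = a.eval m r ^ n := by
  induction n with
  | zero => simp [pow, eval]
  | succ n ih => rw [pow, eval, ih, pow_succ]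

theorem eval_kappa : kappa.eval m r = 1 + m ^ 2 := by
  simp [kappa, eval, pow_two]

end

/-- The coefficients of `S`. -/
def coeffsS : List ℤ :=
  [30911476378259268, -3991355037576144, 195276967064388, -8234002812376, 538400028969,
    -16330240872, 169737744, -20101752, 933174, -27192, 396, 0, 1]

/-- The coefficients of the sextic `a`. -/
def coeffsA : List ℤ := [-31133822, -24189396, 1947657, 46308, -4410, 0, 1]

/-- The coefficients in `x` of the polynomial that vanishes on the curve. -/
def relation : List BiExpr :=
  addX (smulX (mul oddCoeff1 (pow normD 2)) (addX (addX (smulX (pow kappa 6) (coeffsS.map const))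
      (smulX (mul (const 2) (mul (pow kappa 3) paramNum)) (coeffsA.map const)))
      [mul paramNum paramNum]))
    (addX (smulX (neg oddCoeff1) (mulX sexticEven sexticEven))
      (smulX (mul kappa normD) (mulX sexticOdd sexticOdd)))

/-- The base for the variable `m`. -/
def baseM : ℕ := Nat.pow 2 320

/-- The base for the variable `r`. -/
def baseR : ℕ := Nat.pow 2 17920

/-- The modulus for Kronecker substitution. -/
def baseMod : ℕ := Nat.pow 2 512000

/-- The polynomial in `m` read off from the balanced base `B` digits of a natural number. -/
def digitsM (B : ℕ) : ℕ → ℕ → BiExpr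
  | 0, _ => const 0
  | _ + 1, 0 => const 0
  | f + 1, n + 1 =>
    bif Nat.blt (Nat.mul 2 (Nat.mod (n + 1) B)) B then
      add (const (.ofNat (Nat.mod (n + 1) B))) (mul m (digitsM B f (Nat.div (n + 1) B)))
    else
      add (neg (const (.ofNat (Nat.sub B (Nat.mod (n + 1) B)))))
        (mul m (digitsM B f (Nat.succ (Nat.div (n + 1) B))))

/-- The polynomial in `m` and `r` read off from the balanced digits of a natural number. -/
def digitsR (B c : ℕ) : ℕ → ℕ → BiExpr
  | 0, _ => const 0
  | _ + 1, 0 => const 0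
  | f + 1, n + 1 =>
    bif Nat.blt (Nat.mul 2 (Nat.mod (n + 1) c)) c then
      add (digitsM B 100 (Nat.mod (n + 1) c)) (mul r (digitsR B c f (Nat.div (n + 1) c)))
    else
      add (neg (digitsM B 100 (Nat.sub c (Nat.mod (n + 1) c))))
        (mul r (digitsR B c f (Nat.succ (Nat.div (n + 1) c))))

/-- The quotient of two natural numbers that represent integers modulo `M`, as a polynomial. -/
def quotientOfMod (B c M a b : ℕ) : BiExpr :=
  bif Nat.blt (Nat.mul 2 b) M then
    bif Nat.blt (Nat.mul 2 a) M then digitsR B c 100 (Nat.div a b)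
    else neg (digitsR B c 100 (Nat.div (Nat.sub M a) b))
  else
    bif Nat.blt (Nat.mul 2 a) M then neg (digitsR B c 100 (Nat.div a (Nat.sub M b)))
    else digitsR B c 100 (Nat.div (Nat.sub M a) (Nat.sub M b))

/-- Check that an expression is a multiple of the equation of the curve. -/
def isMultiple (a : BiExpr) : Bool :=
  (add a (neg (mul curve (quotientOfMod baseM baseR baseMod (a.evalMod baseMod baseM baseR)
    (curve.evalMod baseMod baseM baseR))))).IsZeroAt baseM baseR baseMod

theorem isMultiple_relation : relation.all isMultiple = true := by
  decide +kernel

theorem eval_eq_zero_of_isMultiple {a : BiExpr} (h : isMultiple a = true) {R : Type*} [CommRing R]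
    {m r : R} (hc : curve.eval m r = 0) : a.eval m r = 0 := by
  have := eval_eq_zero_of_isZeroAt h m r
  rwa [eval, eval, eval, hc, zero_mul, neg_zero, add_zero] at this

theorem evalX_relation {R : Type*} [CommRing R] {m r : R} (x : R) (hc : curve.eval m r = 0) :
    evalX m r x relation = 0 := by
  have h := List.all_eq_true.1 isMultiple_relation
  generalize relation = l at h
  induction l with
  | nil => rfl
  | cons a l ih =>
    rw [evalX, eval_eq_zero_of_isMultiple (h a (by simp)) hc, ih fun b hb => h b (by simp [hb])]
    simp

theorem sextic_identity {R : Type*} [CommRing R] {m r : R} (x : R) (hc : curve.eval m r = 0) :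
    oddCoeff1.eval m r * evalX m r x sexticEven ^ 2 =
      (1 + m ^ 2) * normD.eval m r * evalX m r x sexticOdd ^ 2 +
      oddCoeff1.eval m r * normD.eval m r ^ 2 *
        ((1 + m ^ 2) ^ 6 * evalX m r x (coeffsS.map const) +
        2 * (1 + m ^ 2) ^ 3 * paramNum.eval m r * evalX m r x (coeffsA.map const) +
          paramNum.eval m r ^ 2) := by
  have h := evalX_relation x hc
  simp only [relation, evalX_addX, evalX_smulX, evalX_mulX, eval, eval_pow, eval_kappa] at h
  rw [evalX, eval, evalX, Int.cast_ofNat] at h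
  linear_combination -h

end BiExpr

end Identity

/-! ### Reduction modulo a place and Frobenius elements -/

section Reduction

universe u

/-- Let `A` be a Noetherian integrally closed domain with a homomorphism `φ` to `ZMod p`, and `Ω` a
finite Galois extension of its field of fractions. Then there are a ring `O` between the integral
closure of `A` and `Ω`, an extension `π` of `φ` to `O` all of whose nonzero values come from units,
and an automorphism `σ` of `Ω` that lifts the Frobenius endomorphism. -/
theorem exists_reduction {A K : Type*} {Ω : Type u} [CommRing A] [IsDomain A]
    [IsIntegrallyClosed A] [IsNoetherianRing A] [Field K] [Algebra A K] [IsFractionRing A K]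
    [Field Ω] [Algebra K Ω] [Algebra A Ω] [IsScalarTower A K Ω] [FiniteDimensional K Ω]
    [IsGalois K Ω] (p : ℕ) [Fact p.Prime] (φ : A →+* ZMod p) :
    ∃ (O k : Type u) (_ : CommRing O) (_ : Field k) (_ : Algebra (ZMod p) k) (ι : O →+* Ω)
      (π : O →+* k) (σ : Ω ≃ₐ[K] Ω), Function.Injective ι ∧ (∀ o, π o ≠ 0 → IsUnit o) ∧
      (∀ z, IsIntegral A z → ∃ o, ι o = z) ∧
      (∀ a o, ι o = algebraMap A Ω a → π o = algebraMap (ZMod p) k (φ a)) ∧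
      ∀ o o', IsIntegral A (ι o) → ι o' = σ (ι o) → π o' = π o ^ p := by
  let B := integralClosure A Ω
  have : IsFractionRing B Ω := IsIntegralClosure.isFractionRing_of_finite_extension A K Ω B
  let : MulSemiringAction Gal(Ω/K) B := IsIntegralClosure.MulSemiringAction A K Ω B
  have : IsGaloisGroup Gal(Ω/K) A B := IsGaloisGroup.of_isFractionRing _ _ _ K Ω
  have := IsGaloisGroup.commutes (G := Gal(Ω/K)) (A := A) (B := B)
  have := IsGaloisGroup.isInvariant (G := Gal(Ω/K)) (A := A) (B := B)
  have hfin : Module.Finite A B := IsIntegralClosure.finite A K Ω B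
  have hinj : Function.Injective (algebraMap A B) := by
    have : Function.Injective (algebraMap A Ω) := by
      rw [IsScalarTower.algebraMap_eq A K Ω]
      exact (algebraMap K Ω).injective.comp (IsFractionRing.injective A K)
    exact Function.Injective.of_comp (f := algebraMap B Ω) this
  have hφ : Function.Surjective φ := ZMod.ringHom_surjective φ
  have hP : (RingHom.ker φ).IsMaximal := RingHom.ker_isMaximal_of_surjective φ hφ
  obtain ⟨Q, hQ, hQP⟩ : ∃ Q : Ideal B, Q.IsPrime ∧ Q.comap (algebraMap A B) = RingHom.ker φ := by
    obtain ⟨Q, -, hQ⟩ := Ideal.exists_ideal_over_prime_of_isIntegral (S := B) (RingHom.ker φ) ⊥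
      (by
        rw [← RingHom.ker_eq_comap_bot, (RingHom.injective_iff_ker_eq_bot _).1 hinj]
        exact bot_le)
    exact ⟨Q, hQ.1, hQ.2⟩
  have hover : Q.LiesOver (RingHom.ker φ) := ⟨hQP.symm⟩
  let hequiv := RingHom.quotientKerEquivOfSurjective hφ
  have hfinA : Finite (A ⧸ RingHom.ker φ) := Finite.of_equiv _ hequiv.symm.toEquiv
  have hfinB : Finite (B ⧸ Q) := Module.finite_of_finite (A ⧸ RingHom.ker φ)
  obtain ⟨σ, hσ⟩ := IsArithFrobAt.exists_of_isInvariant A (Ω ≃ₐ[K] Ω) Q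
  have hcard : Nat.card (A ⧸ Q.under A) = p := by
    rw [Ideal.under, hQP, Nat.card_congr hequiv.toEquiv, Nat.card_zmod]
  let O := Localization.AtPrime Q
  let k := IsLocalRing.ResidueField O
  let π : O →+* k := IsLocalRing.residue O
  have hle : Q.primeCompl ≤ nonZeroDivisors B := Ideal.primeCompl_le_nonZeroDivisors Q
  let ι : O →+* Ω := IsLocalization.lift (M := Q.primeCompl) (g := algebraMap B Ω) fun y => by
    rw [isUnit_iff_ne_zero]
    intro h
    exact nonZeroDivisors.ne_zero (hle y.2) (Subtype.ext h)
  have hι : ∀ b : B, ι (algebraMap B O b) = b := fun b => IsLocalization.lift_eq _ b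
  have hιinj : Function.Injective ι := by
    refine (IsLocalization.lift_injective_iff _).2 fun x y => ?_
    rw [(IsLocalization.injective O hle).eq_iff]
    exact Subtype.ext_iff
  have hπ : ∀ b : B, π (algebraMap B O b) = 0 ↔ b ∈ Q := by
    intro b
    rw [IsLocalRing.residue_eq_zero_iff, IsLocalization.AtPrime.to_map_mem_maximal_iff O Q]
  let ψ : ZMod p →+* k := (Ideal.Quotient.lift (RingHom.ker φ) ((π.comp (algebraMap B O)).comp
    (algebraMap A B)) fun a ha => (hπ _).2 (by rwa [← hQP] at ha)).comp hequiv.symm.toRingHom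
  have hψ : ∀ a, ψ (φ a) = π (algebraMap B O (algebraMap A B a)) := by
    intro a
    have : hequiv.symm (φ a) = Ideal.Quotient.mk _ a := by
      rw [RingEquiv.symm_apply_eq]; rfl
    simp [ψ, this]
  refine ⟨O, k, inferInstance, inferInstance, ψ.toAlgebra, ι, π, σ, hιinj, ?_, ?_, ?_, ?_⟩
  · intro o ho
    by_contra h
    exact ho ((IsLocalRing.residue_eq_zero_iff o).2 ((IsLocalRing.mem_maximalIdeal o).2 h))
  · intro z hz
    exact ⟨algebraMap B O ⟨z, hz⟩, hι _⟩
  · intro a o h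
    have : o = algebraMap B O (algebraMap A B a) := hιinj (h.trans (hι (algebraMap A B a)).symm)
    rw [this, ← hψ]; rfl
  · intro o o' ho h
    have h1 : o = algebraMap B O ⟨ι o, ho⟩ := hιinj (hι ⟨ι o, ho⟩).symm
    have h2 : o' = algebraMap B O (σ • ⟨ι o, ho⟩) := by
      apply hιinj
      rw [h, hι]
      exact (algebraMap_galRestrict_apply A (B := B) σ ⟨ι o, ho⟩).symm
    have h3 := (hπ _).2 (hσ ⟨ι o, ho⟩)
    rw [hcard, map_sub, map_sub, sub_eq_zero, map_pow, map_pow, ← h1] at h3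
    rw [h2]
    exact h3

end Reduction

/-! ### Places of extensions of the rational function field -/

section Places

universe u

/-- The value at `x` of a polynomial with the given integral coefficients. -/
def evalList {R : Type*} [CommRing R] (x : R) : List ℤ → R
  | [] => 0
  | a :: l => a + x * evalList x l

theorem map_evalList {R S : Type*} [CommRing R] [CommRing S] (f : R →+* S) (x : R) (l : List ℤ) :
    f (evalList x l) = evalList (f x) l := by
  induction l with
  | nil => simp [evalList]
  | cons a l ih => simp [evalList, ih]

theorem BiExpr.evalX_map_const {R : Type*} [CommRing R] (m r x : R) (l : List ℤ) :
    evalX m r x (l.map const) = evalList x l := by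
  induction l with
  | nil => rfl
  | cons a l ih => simp [evalX, evalList, eval, ih]

/-- The polynomial of degree twelve in `x` with parameter `s` whose norm to `ℚ(s ^ 2)` is the
polynomial of degree twenty-four under consideration. -/
def branch {R : Type*} [CommRing R] (s x : R) : R :=
  evalList x BiExpr.coeffsS - 2 * s * evalList x BiExpr.coeffsA + s ^ 2

theorem map_branch {R S : Type*} [CommRing R] [CommRing S] (f : R →+* S) (s x : R) :
    f (branch s x) = branch (f s) (f x) := by
  simp [branch, map_evalList, map_ofNat]

/-- `branch` as a polynomial in `x`. -/
noncomputable def dodecic {R : Type*} [CommRing R] (s : R) : R[X] := branch (C s) X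

theorem map_dodecic {R S : Type*} [CommRing R] [CommRing S] (f : R →+* S) (s : R) :
    (dodecic s).map f = dodecic (f s) := by
  rw [← coe_mapRingHom, dodecic, map_branch, dodecic]; simp

theorem eval_dodecic {R : Type*} [CommRing R] (s x : R) : (dodecic s).eval x = branch s x := by
  rw [← coe_evalRingHom, dodecic, map_branch]; simp

theorem monic_dodecic {R : Type*} [CommRing R] (s : R) : (dodecic s).Monic := by
  simp only [dodecic, branch, evalList, BiExpr.coeffsS, BiExpr.coeffsA, mul_zero, add_zero, Int.cast_one,
    mul_one, Int.cast_zero, zero_add]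
  monicity!

theorem natDegree_dodecic {R : Type*} [CommRing R] [Nontrivial R] (s : R) :
    (dodecic s).natDegree = 12 := by
  simp only [dodecic, branch, evalList, BiExpr.coeffsS, BiExpr.coeffsA, mul_zero, add_zero, Int.cast_one,
    mul_one, Int.cast_zero, zero_add]
  compute_degree!

/-- The constant `2 ^ 2 * 3 ^ 6 * 11 ^ 11`, the ratio of `s ^ 2` and `t - 1`. -/
def scale : ℤ := 2 ^ 2 * 3 ^ 6 * 11 ^ 11

/-- The inclusion of integral polynomials in rational functions. -/
noncomputable abbrev intPolyToRatFunc : ℤ[X] →+* RatFunc ℚ :=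
  (algebraMap ℚ[X] (RatFunc ℚ)).comp (mapRingHom (Int.castRingHom ℚ))

theorem isFractionRing_intPoly :
    let := intPolyToRatFunc.toAlgebra
    IsFractionRing ℤ[X] (RatFunc ℚ) := by
  intro _
  have key : ∀ f : ℚ[X], ∃ (b : ℤ) (g : ℤ[X]), b ≠ 0 ∧
      algebraMap ℚ[X] (RatFunc ℚ) f = intPolyToRatFunc g / intPolyToRatFunc (C b) := by
    intro f
    obtain ⟨b, hb', hb⟩ := IsLocalization.integerNormalization_spec (nonZeroDivisors ℤ) f
    have hb0 : b ≠ 0 := nonZeroDivisors.ne_zero hb'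
    refine ⟨b, IsLocalization.integerNormalization (nonZeroDivisors ℤ) f, hb0, ?_⟩
    have h : intPolyToRatFunc (C b) ≠ 0 := by
      simp [hb0]
    rw [eq_div_iff h]
    simp only [RingHom.comp_apply, coe_mapRingHom, ← map_mul]
    congr 1
    rw [show (Int.castRingHom ℚ) = algebraMap ℤ ℚ from rfl, hb]
    simp [zsmul_eq_mul, mul_comm]
  have hinj : Function.Injective intPolyToRatFunc :=
    (IsFractionRing.injective ℚ[X] (RatFunc ℚ)).comp
      (map_injective _ (RingHom.injective_int _))
  have : FaithfulSMul ℤ[X] (RatFunc ℚ) := (faithfulSMul_iff_algebraMap_injective _ _).2 hinj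
  refine IsFractionRing.of_field _ _ fun z => ?_
  obtain ⟨f, g, -, rfl⟩ := IsFractionRing.div_surjective (A := ℚ[X]) z
  obtain ⟨b, f', hb, hf⟩ := key f
  obtain ⟨c, g', hc, hg⟩ := key g
  refine ⟨f' * C c, g' * C b, ?_⟩
  rw [hf, hg]
  change _ = intPolyToRatFunc _ / intPolyToRatFunc _
  rw [map_mul, map_mul, div_div_div_eq, mul_comm (intPolyToRatFunc (C b))]

theorem norm_branch {R : Type*} [CommRing R] (s x : R) : branch s x * branch (-s) x =
    (evalList x BiExpr.coeffsS + s ^ 2) ^ 2 - 4 * s ^ 2 * evalList x BiExpr.coeffsA ^ 2 := by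
  simp only [branch]; ring

/-- The polynomial of degree twenty-four in `x` with parameter `T = s ^ 2`. -/
noncomputable def normPoly {R : Type*} [CommRing R] (T : R) : R[X] :=
  (evalList X BiExpr.coeffsS + C T) ^ 2 - 4 * C T * evalList X BiExpr.coeffsA ^ 2

theorem normPoly_sq {R : Type*} [CommRing R] (s : R) :
    normPoly (s ^ 2) = dodecic s * dodecic (-s) := by
  simp [dodecic, norm_branch, normPoly]

theorem map_normPoly {R S : Type*} [CommRing R] [CommRing S] (f : R →+* S) (T : R) :
    (normPoly T).map f = normPoly (f T) := by
  rw [← coe_mapRingHom, normPoly, normPoly]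
  simp only [map_sub, map_pow, map_add, map_mul, map_ofNat, map_evalList]
  simp

theorem monic_normPoly {R : Type*} [CommRing R] (T : R) : (normPoly T).Monic := by
  simp only [normPoly, evalList, BiExpr.coeffsS, BiExpr.coeffsA, mul_zero, add_zero, Int.cast_one,
    mul_one, Int.cast_zero, zero_add]
  monicity!

theorem natDegree_normPoly {R : Type*} [CommRing R] [Nontrivial R] (T : R) :
    (normPoly T).natDegree = 24 := by
  simp only [normPoly, evalList, BiExpr.coeffsS, BiExpr.coeffsA, mul_zero, add_zero, Int.cast_one,
    mul_one, Int.cast_zero, zero_add]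
  compute_degree!

end Places

section Places

universe u

variable {Ω : Type u} [Field Ω] [Algebra (RatFunc ℚ) Ω]

theorem eq_or_eq_neg_of_sq_mem {s : Ω} {c : RatFunc ℚ} (hs : s ^ 2 = algebraMap (RatFunc ℚ) Ω c)
    (σ : Ω ≃ₐ[RatFunc ℚ] Ω) : σ s = s ∨ σ s = -s := by
  rw [← sq_eq_sq_iff_eq_or_eq_neg, ← map_pow, hs, AlgEquiv.commutes]

theorem branch_symm_of_sq_mem {s : Ω} {c : RatFunc ℚ} (hs : s ^ 2 = algebraMap (RatFunc ℚ) Ω c)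
    (σ : Ω ≃ₐ[RatFunc ℚ] Ω) {x : Ω} (hx : branch s x = 0 ∨ branch (-s) x = 0) :
    branch s (σ x) = 0 ∨ branch (-s) (σ x) = 0 := by
  rcases eq_or_eq_neg_of_sq_mem hs σ with h | h <;> rcases hx with hx | hx <;>
  replace hx := congrArg (σ : Ω →+* Ω) hx <;> rw [map_branch] at hx <;> simp_all

/-- A place of `Ω` at which the square root `s` of a constant multiple of `t - 1` reduces to a given
nonzero element of `ZMod p`, together with a Frobenius automorphism fixing `s`. -/
theorem exists_place [FiniteDimensional (RatFunc ℚ) Ω] [IsGalois (RatFunc ℚ) Ω] {s : Ω}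
    (hs : s ^ 2 = algebraMap (RatFunc ℚ) Ω ((scale : RatFunc ℚ) * (RatFunc.X - 1)))
    (τ : Ω ≃ₐ[RatFunc ℚ] Ω) (hτ : τ s = -s) {p : ℕ} [Fact p.Prime] (s₀ : ZMod p) (hs₀ : s₀ ≠ 0)
    (h2 : (2 : ZMod p) ≠ 0) (hscale : (scale : ZMod p) ≠ 0) :
    ∃ (O k : Type u) (_ : CommRing O) (_ : Field k) (_ : Algebra (ZMod p) k) (ι : O →+* Ω)
      (π : O →+* k) (σ : Ω ≃ₐ[RatFunc ℚ] Ω), Function.Injective ι ∧ (∀ o, π o ≠ 0 → IsUnit o) ∧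
      (∃ o, ι o = s ∧ π o = algebraMap (ZMod p) k s₀) ∧ σ s = s ∧
      (∀ x, branch s x = 0 ∨ branch (-s) x = 0 → ∃ o, ι o = x) ∧
      ∀ o o', branch s (ι o) = 0 ∨ branch (-s) (ι o) = 0 → ι o' = σ (ι o) → π o' = π o ^ p := by
  let _ : Algebra ℤ[X] (RatFunc ℚ) := intPolyToRatFunc.toAlgebra
  have : IsFractionRing ℤ[X] (RatFunc ℚ) := isFractionRing_intPoly
  let _ : Algebra ℤ[X] Ω := ((algebraMap (RatFunc ℚ) Ω).comp intPolyToRatFunc).toAlgebra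
  have : IsScalarTower ℤ[X] (RatFunc ℚ) Ω := IsScalarTower.of_algebraMap_eq fun _ => rfl
  have hmap : ∀ f, algebraMap ℤ[X] Ω f = algebraMap (RatFunc ℚ) Ω (intPolyToRatFunc f) :=
    fun _ => rfl
  let T : ℤ[X] := C scale * (X - 1)
  have hT : algebraMap ℤ[X] Ω T = s ^ 2 := by
    rw [hs, hmap]
    simp [T, RatFunc.algebraMap_X]
  obtain ⟨O, k, _, _, _, ι, π, σ, hι, hunit, hint, hred, hfrob⟩ :=
    exists_reduction (K := RatFunc ℚ) (Ω := Ω) p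
      (eval₂RingHom (Int.castRingHom (ZMod p)) (1 + s₀ ^ 2 / scale))
  have hs_int : IsIntegral ℤ[X] s := by
    refine IsIntegral.of_pow (n := 2) two_pos ?_
    rw [← hT]
    exact isIntegral_algebraMap
  have hroot_int : ∀ x, branch s x = 0 ∨ branch (-s) x = 0 → IsIntegral ℤ[X] x := by
    intro x hx
    refine ⟨normPoly T, monic_normPoly T, ?_⟩
    rw [← eval_map, map_normPoly, hT, normPoly_sq, eval_mul, eval_dodecic, eval_dodecic]
    exact mul_eq_zero.2 hx
  obtain ⟨S, hS⟩ := hint s hs_int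
  have hπS : π S = algebraMap (ZMod p) k s₀ ∨ π S = -algebraMap (ZMod p) k s₀ := by
    rw [← sq_eq_sq_iff_eq_or_eq_neg, ← map_pow, ← map_pow, hred T (S ^ 2) (by rw [map_pow, hS, hT])]
    congr 1
    simp only [T, coe_eval₂RingHom, eval₂_mul, eval₂_C, eval₂_sub, eval₂_X, eval₂_one]
    simp [mul_div_cancel₀ _ hscale]
  have hne : algebraMap (ZMod p) k s₀ ≠ 0 := by simpa using hs₀
  have h2k : (2 : k) ≠ 0 := by
    intro h
    apply h2
    apply (algebraMap (ZMod p) k).injective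
    rw [map_ofNat, map_zero, h]
  have hπSp : π S ^ p = π S := by
    rcases hπS with h | h
    · rw [h, ← map_pow, ZMod.pow_card]
    · rw [h, ← map_neg, ← map_pow, ZMod.pow_card]
  have hσ : σ s = s := by
    rcases eq_or_eq_neg_of_sq_mem hs σ with h | h
    · exact h
    · exfalso
      have h1 := hfrob S (-S) (by rwa [hS]) (by rw [map_neg, hS, h])
      rw [hπSp, map_neg, neg_eq_iff_add_eq_zero, ← two_mul] at h1
      have h3 : π S = 0 := (mul_eq_zero.1 h1).resolve_left h2k
      rw [h3] at hπS
      rcases hπS with h | h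
      · exact hne h.symm
      · exact hne (by rw [← neg_zero, h, neg_neg])
  rcases hπS with h | h
  · exact ⟨O, k, inferInstance, inferInstance, inferInstance, ι, π, σ, hι, hunit, ⟨S, hS, h⟩,
      hσ, fun x hx => hint x (hroot_int x hx), fun o o' ho h' => hfrob o o' (hroot_int _ ho) h'⟩
  · have hτ' : τ⁻¹ s = -s := by
      rw [AlgEquiv.aut_inv, AlgEquiv.symm_apply_eq, map_neg, hτ, neg_neg]
    have hττ' : ∀ x, τ⁻¹ (τ x) = x := fun x => τ.symm_apply_apply x
    refine ⟨O, k, inferInstance, inferInstance, inferInstance, (τ : Ω →+* Ω).comp ι, π,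
      τ * σ * τ⁻¹, τ.injective.comp hι, hunit,
      ⟨-S, by simp [hS, hτ], by simp [h]⟩, by simp [hτ', hσ, hτ], fun x hx => ?_,
      fun o o' ho h' => ?_⟩
    · obtain ⟨o, ho⟩ := hint (τ⁻¹ x) (hroot_int _ (branch_symm_of_sq_mem hs τ⁻¹ hx))
      exact ⟨o, by simp [ho]⟩
    · refine hfrob o o' (hroot_int _ ?_) ?_
      · have := branch_symm_of_sq_mem hs τ⁻¹ ho
        rwa [show τ⁻¹ (((τ : Ω →+* Ω).comp ι) o) = ι o from hττ' _] at this
      · apply τ.injective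
        simpa [hττ'] using h'

end Places

/-! ### Arithmetic of polynomials over a prime field -/

section ListArithmetic

/-- Polynomials over `ZMod p` represented by the lists of their coefficients, as natural numbers. -/
abbrev ModPoly : Type := List ℕ

namespace ModPoly

/-- The value of a polynomial. -/
def eval {R : Type*} [CommRing R] (x : R) : ModPoly → R
  | [] => 0
  | a :: l => a + x * eval x l

/-- Sum modulo `p`. -/
def add (p : ℕ) : ModPoly → ModPoly → ModPoly
  | [], l => l
  | a :: k, [] => a :: k
  | a :: k, b :: l => Nat.mod (Nat.add a b) p :: add p k l

/-- Multiplication by a constant modulo `p`. -/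
def smul (p c : ℕ) : ModPoly → ModPoly
  | [] => []
  | a :: l => Nat.mod (Nat.mul c a) p :: smul p c l

/-- Product modulo `p`. -/
def mul (p : ℕ) : ModPoly → ModPoly → ModPoly
  | [], _ => []
  | a :: k, l => add p (smul p a l) (0 :: mul p k l)

/-- Difference modulo `p`. -/
def sub (p : ℕ) (k l : ModPoly) : ModPoly := add p k (smul p (Nat.sub p 1) l)

/-- Product modulo `p` and modulo `x ^ d - q`. -/
def mulMod (p d : ℕ) (q : ModPoly) : ModPoly → ModPoly → ModPoly
  | [], _ => []
  | a :: k, l =>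
    let z := 0 :: mulMod p d q k l
    add p (smul p a l) (add p (z.take d) (mul p (z.drop d) q))

/-- Powers modulo `p` and modulo `x ^ d - q`. -/
def powMod (p d : ℕ) (q l : ModPoly) : ℕ → ModPoly
  | 0 => [1]
  | n + 1 => mulMod p d q l (powMod p d q l n)

/-- The power `x ^ p ^ n` modulo `p` and modulo `x ^ d - q`. -/
def frobMod (p d : ℕ) (q : ModPoly) : ℕ → ModPoly
  | 0 => [0, 1]
  | n + 1 => powMod p d q (frobMod p d q n) p

/-- The derivative modulo `p`. -/
def deriv (p : ℕ) : ModPoly → ModPoly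
  | [] => []
  | _ :: l => add p l (0 :: deriv p l)

/-- Whether all coefficients are zero. -/
def isZero (l : ModPoly) : Bool := l.all fun a => Nat.beq a 0

/-- Reduction modulo `p` of a list of integral coefficients. -/
def ofInt (p : ℕ) (l : List ℤ) : ModPoly := l.map fun a => Int.toNat (a % (p : ℤ))

/-- The monic polynomial with the given lower coefficients. -/
def monic (l : ModPoly) : ModPoly := l ++ [1]

section

variable {R : Type*} [CommRing R] {p : ℕ} [CharP R p] (x : R)

theorem cast_mod (a : ℕ) : ((Nat.mod a p : ℕ) : R) = a := CharP.cast_eq_mod R p a ▸ rfl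

variable (p) in
theorem eval_add (k l : ModPoly) : eval x (add p k l) = eval x k + eval x l := by
  fun_induction add p k l with
  | case1 => simp [eval]
  | case2 => simp [eval]
  | case3 a k b l ih => rw [eval, ih, cast_mod, eval, eval, Nat.add_eq, Nat.cast_add]; ring

variable (p) in
theorem eval_smul (c : ℕ) (l : ModPoly) : eval x (smul p c l) = c * eval x l := by
  induction l with
  | nil => simp [smul, eval]
  | cons a l ih => rw [smul, eval, ih, cast_mod, eval, Nat.mul_eq, Nat.cast_mul]; ring

variable (p) in
theorem eval_mul (k l : ModPoly) : eval x (mul p k l) = eval x k * eval x l := by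
  induction k with
  | nil => simp [mul, eval]
  | cons a k ih => rw [mul, eval_add, eval_smul, eval, ih, eval]; push_cast; ring

variable (p) in
theorem eval_sub [Fact p.Prime] (k l : ModPoly) : eval x (sub p k l) = eval x k - eval x l := by
  rw [sub, eval_add, eval_smul, Nat.sub_eq, Nat.cast_sub (Fact.out : p.Prime).one_le,
    CharP.cast_eq_zero]
  push_cast; ring

theorem eval_append (k l : ModPoly) : eval x (k ++ l) = eval x k + x ^ k.length * eval x l := by
  induction k with
  | nil => simp [eval]
  | cons a k ih => simp only [List.cons_append, eval, ih, List.length_cons]; ring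

theorem eval_eq_take_add_drop (d : ℕ) {q : ModPoly} (hq : x ^ d = eval x q) (l : ModPoly) :
    eval x l = eval x (l.take d) + eval x q * eval x (l.drop d) := by
  rcases le_total d l.length with h | h
  · conv_lhs => rw [← List.take_append_drop d l, eval_append, List.length_take, min_eq_left h, hq]
  · simp [List.take_of_length_le h, List.drop_of_length_le h, eval]

variable (p) in
theorem eval_mulMod {d : ℕ} {q : ModPoly} (hq : x ^ d = eval x q) (k l : ModPoly) :
    eval x (mulMod p d q k l) = eval x k * eval x l := by
  induction k with
  | nil => simp [mulMod, eval]
  | cons a k ih =>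
    have := eval_eq_take_add_drop x d hq (0 :: mulMod p d q k l)
    rw [mulMod, eval_add, eval_add, eval_smul, eval_mul, mul_comm (eval x _) (eval x q), ← this,
      eval, eval, ih]
    push_cast; ring

variable (p) in
theorem eval_powMod {d : ℕ} {q : ModPoly} (hq : x ^ d = eval x q) (l : ModPoly) (n : ℕ) :
    eval x (powMod p d q l n) = eval x l ^ n := by
  induction n with
  | zero => simp [powMod, eval]
  | succ n ih => rw [powMod, eval_mulMod p x hq, ih, pow_succ']

variable (p) in
theorem eval_frobMod {d : ℕ} {q : ModPoly} (hq : x ^ d = eval x q) (n : ℕ) :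
    eval x (frobMod p d q n) = x ^ p ^ n := by
  induction n with
  | zero => simp [frobMod, eval]
  | succ n ih => rw [frobMod, eval_powMod p x hq, ih, ← pow_mul, ← pow_succ]

variable (p) in
theorem derivative_eval_X (l : ModPoly) :
    derivative (eval (X : R[X]) l) = eval X (deriv p l) := by
  induction l with
  | nil => simp [eval, deriv]
  | cons a l ih =>
    rw [eval, deriv, eval_add, eval]
    simp [ih]

theorem eval_eq_zero {l : ModPoly} (h : isZero l = true) : eval x l = 0 := by
  induction l with
  | nil => rfl
  | cons a l ih =>
    rw [isZero, List.all_cons, Bool.and_eq_true] at h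
    rw [eval, ih h.2, Nat.eq_of_beq_eq_true h.1]; simp

theorem eval_ofInt [Fact p.Prime] (l : List ℤ) : eval x (ofInt p l) = evalList x l := by
  induction l with
  | nil => rfl
  | cons a l ih =>
    rw [ofInt, List.map_cons, eval, evalList, ← ih, ofInt]
    congr 1
    have hp : (p : ℤ) ≠ 0 := by exact_mod_cast (Fact.out : p.Prime).ne_zero
    rw [← Int.cast_natCast, Int.toNat_of_nonneg (Int.emod_nonneg a hp)]
    conv_rhs => rw [← Int.emod_add_mul_ediv a p]
    simp

theorem eval_monic (l : ModPoly) : eval x (monic l) = eval x l + x ^ l.length := by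
  rw [monic, eval_append]; simp [eval]

theorem map_eval {S : Type*} [CommRing S] (f : R →+* S) (l : ModPoly) :
    f (eval x l) = eval (f x) l := by
  induction l with
  | nil => simp [eval]
  | cons a l ih => simp [eval, ih]

theorem degree_eval_X_lt [Nontrivial R] (l : ModPoly) : (eval (X : R[X]) l).degree < l.length := by
  induction l with
  | nil => simp [eval]
  | cons a l ih =>
    rw [eval]
    refine (degree_add_le _ _).trans_lt (max_lt ?_ ?_)
    · exact (degree_natCast_le a).trans_lt (by exact_mod_cast Nat.succ_pos _)
    · rw [mul_comm]
      by_cases h : eval (X : R[X]) l = 0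
      · simp [h]
      · rw [degree_mul_X, List.length_cons, Nat.cast_succ]
        exact WithBot.add_lt_add_right (by simp) ih

theorem natDegree_eval_X_monic [Nontrivial R] (l : ModPoly) :
    (eval (X : R[X]) (monic l)).natDegree = l.length := by
  rw [eval_monic, add_comm]
  apply natDegree_eq_of_degree_eq_some
  have h : (eval (X : R[X]) l).degree < (X ^ l.length : R[X]).degree := by
    rw [degree_X_pow]; exact degree_eval_X_lt l
  rw [degree_add_eq_left_of_degree_lt h, degree_X_pow]

end

end ModPoly

end ListArithmetic

/-! ### Roots and their reductions -/

section Roots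

universe u

/-- A family of twelve lifts of the roots of `dodecic s`. -/
theorem exists_dodecic_eq_prod {O Ω : Type*} [CommRing O] [Field Ω] (ι : O →+* Ω)
    (hι : Function.Injective ι) (S : O) (hsplit : (dodecic (ι S)).Splits)
    (hlift : ∀ x, branch (ι S) x = 0 → ∃ o, ι o = x) :
    ∃ os : Fin 12 → O, dodecic S = ∏ i, (X - C (os i)) := by
  have hcard : (dodecic (ι S)).roots.card = 12 := by
    rw [← natDegree_dodecic (ι S)]
    exact hsplit.natDegree_eq_card_roots.symm
  obtain ⟨l, hl⟩ := Quot.exists_rep (dodecic (ι S)).roots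
  change (l : Multiset Ω) = _ at hl
  have hlen : l.length = 12 := by rw [← hcard, ← hl]; rfl
  have hmem : ∀ i : Fin 12, branch (ι S) (l.get (i.cast hlen.symm)) = 0 := by
    intro i
    have : l.get (i.cast hlen.symm) ∈ (dodecic (ι S)).roots := by
      rw [← hl]; exact List.get_mem _ _
    rw [← eval_dodecic]
    exact isRoot_of_mem_roots this
  choose os hos using fun i => hlift _ (hmem i)
  refine ⟨os, ?_⟩
  apply map_injective ι hι
  rw [map_dodecic, Polynomial.map_prod, hsplit.eq_prod_roots_of_monic (monic_dodecic _), ← hl,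
    Multiset.map_coe, Multiset.prod_coe, ← List.prod_ofFn]
  congr 1
  apply List.ext_get
  · rw [List.length_map, List.length_ofFn, hlen]
  · intro i h1 h2
    rw [List.get_ofFn]
    simp only [List.get_eq_getElem, List.getElem_map, Polynomial.map_sub, map_X, map_C, hos,
      Fin.val_cast]

/-- The lifts are distinct modulo a map under which `dodecic s` becomes separable. -/
theorem injective_comp_of_dodecic_eq_prod {O k : Type*} [CommRing O] [Field k] (π : O →+* k) {S : O}
    {os : Fin 12 → O} (hprod : dodecic S = ∏ i, (X - C (os i)))
    (hsep : ∀ a, branch (π S) a = 0 → (derivative (dodecic (π S))).eval a ≠ 0) :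
    Function.Injective (π ∘ os) := by
  intro i j hij
  by_contra hne
  have hk : dodecic (π S) = ∏ i, (X - C (π (os i))) := by
    rw [← map_dodecic, hprod, Polynomial.map_prod]; simp
  have hdvd : (X - C (π (os i))) ^ 2 ∣ dodecic (π S) := by
    have h1 : (X - C (π (os i))) ^ 2 = ∏ x ∈ {i, j}, (X - C (π (os x))) := by
      rw [Finset.prod_pair hne, pow_two]
      simp only [Function.comp_apply] at hij
      rw [hij]
    rw [h1, hk]
    exact Finset.prod_dvd_prod_of_subset _ _ _ (Finset.subset_univ _)
  obtain ⟨g, hg⟩ := hdvd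
  refine hsep (π (os i)) ?_ ?_
  · rw [← eval_dodecic, hg]; simp
  · rw [hg]; simp [derivative_mul, derivative_pow]

/-- The roots of `dodecic s`. -/
def RootSet {Ω : Type u} [Field Ω] (s : Ω) : Type u := {x : Ω // branch s x = 0}

variable {Ω : Type u} [Field Ω]

instance (s : Ω) : Finite (RootSet s) := by
  refine Set.Finite.subset (Polynomial.rootSet_finite (dodecic s) Ω) fun x hx => ?_
  rw [mem_rootSet]
  refine ⟨(monic_dodecic s).ne_zero, ?_⟩
  rw [coe_aeval_eq_eval, eval_dodecic]
  exact hx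

section

variable {K : Type*} [Field K] [Algebra K Ω]

instance (s : Ω) : MulAction (MulAction.stabilizer (Ω ≃ₐ[K] Ω) s) (RootSet s) where
  smul σ x := ⟨σ.1 x.1, by
    have h : σ.1 s = s := σ.2
    have := congrArg (σ.1 : Ω →+* Ω) x.2
    rw [map_branch, map_zero] at this
    change branch (σ.1 s) (σ.1 x.1) = 0 at this
    rwa [h] at this⟩
  one_smul _ := rfl
  mul_smul _ _ _ := rfl

end

/-- A Frobenius automorphism at a place where `dodecic s` reduces to a separable polynomial. -/
theorem exists_frobenius [Algebra (RatFunc ℚ) Ω] [FiniteDimensional (RatFunc ℚ) Ω]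
    [IsGalois (RatFunc ℚ) Ω] {s : Ω} [Fintype (RootSet s)]
    (hs : s ^ 2 = algebraMap (RatFunc ℚ) Ω ((scale : RatFunc ℚ) * (RatFunc.X - 1)))
    (τ : Ω ≃ₐ[RatFunc ℚ] Ω) (hτ : τ s = -s) (hsplit : (dodecic s).Splits)
    {p : ℕ} [Fact p.Prime] (s₀ : ZMod p) (hs₀ : s₀ ≠ 0)
    (h2 : (2 : ZMod p) ≠ 0) (hscale : (scale : ZMod p) ≠ 0)
    (hsep : ∀ (k : Type u) [Field k] [Algebra (ZMod p) k] (a : k),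
      branch (algebraMap (ZMod p) k s₀) a = 0 →
      (derivative (dodecic (algebraMap (ZMod p) k s₀))).eval a ≠ 0) :
    ∃ (k : Type u) (_ : Field k) (_ : Algebra (ZMod p) k)
      (σ : MulAction.stabilizer (Ω ≃ₐ[RatFunc ℚ] Ω) s) (r : RootSet s → k),
      Function.Injective r ∧ dodecic (algebraMap (ZMod p) k s₀) = ∏ x, (X - C (r x)) ∧
      ∀ x, r (σ • x) = r x ^ p := by
  obtain ⟨O, k, _, _, _, ι, π, σ, hι, -, ⟨S, hS, hπS⟩, hσ, hlift, hfrob⟩ :=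
    exists_place hs τ hτ s₀ hs₀ h2 hscale
  subst hS
  obtain ⟨os, hos⟩ := exists_dodecic_eq_prod ι hι S hsplit fun x hx => hlift x (.inl hx)
  have hinj := injective_comp_of_dodecic_eq_prod π hos (by rw [hπS]; exact hsep k)
  have hΩ : dodecic (ι S) = ∏ i, (X - C (ι (os i))) := by
    rw [← map_dodecic, hos, Polynomial.map_prod]; simp
  have hbranch : ∀ x, branch (ι S) x = 0 ↔ ∃ i, ι (os i) = x := by
    intro x
    rw [← eval_dodecic, hΩ, eval_prod, Finset.prod_eq_zero_iff]
    simp [sub_eq_zero, @eq_comm _ x]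
  let e : Fin 12 ≃ RootSet (ι S) := Equiv.ofBijective (fun i => ⟨ι (os i), (hbranch _).2 ⟨i, rfl⟩⟩)
    ⟨fun i j h => hinj (congrArg π (hι (congrArg Subtype.val h))), fun x => by
      obtain ⟨i, hi⟩ := (hbranch x.1).1 x.2
      exact ⟨i, Subtype.ext hi⟩⟩
  have he : ∀ x, ι (os (e.symm x)) = x.1 := fun x => congrArg Subtype.val (e.apply_symm_apply x)
  refine ⟨k, inferInstance, inferInstance, ⟨σ, hσ⟩, π ∘ os ∘ e.symm, ?_, ?_, fun x => ?_⟩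
  · exact hinj.comp e.symm.injective
  · rw [← hπS, ← map_dodecic, hos, Polynomial.map_prod,
      ← Equiv.prod_comp e fun x => X - C ((π ∘ os ∘ e.symm) x)]
    simp
  · refine hfrob (os (e.symm x)) (os (e.symm _)) (.inl ?_) ?_
    · rw [he]; exact x.2
    · rw [he, he]; rfl

/-- The number of roots of a divisor of a product of distinct linear factors. -/
theorem card_filter_eval_eq_zero {k ι : Type*} [Field k] [Fintype ι] {r : ι → k}
    (hr : Function.Injective r) {f l : k[X]} (hf : f = ∏ x, (X - C (r x))) (hl : l ∣ f)
    [DecidablePred fun x => l.eval (r x) = 0] :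
    (Finset.univ.filter fun x => l.eval (r x) = 0).card = l.natDegree := by
  classical
  have hroots : f.roots = Finset.univ.val.map r := by
    rw [hf, ← Finset.prod_map_val, Multiset.map_congr rfl fun x _ => rfl]
    rw [show (Finset.univ.val.map fun x => X - C (r x)) =
      (Finset.univ.val.map r).map fun a => X - C a by simp]
    exact roots_multiset_prod_X_sub_C _
  have hf0 : f ≠ 0 := by
    rw [hf]; exact Finset.prod_ne_zero_iff.2 fun x _ => X_sub_C_ne_zero _
  have hsplit : f.Splits := by
    rw [hf]; exact Splits.prod fun x _ => Splits.X_sub_C _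
  have hl0 : l ≠ 0 := ne_zero_of_dvd_ne_zero hf0 hl
  have hnodup : l.roots.Nodup := by
    refine Multiset.nodup_of_le (roots.le_of_dvd hf0 hl) ?_
    rw [hroots]
    exact Finset.univ.nodup.map hr
  rw [(hsplit.of_dvd hf0 hl).natDegree_eq_card_roots, ← Multiset.toFinset_card_of_nodup hnodup,
    ← Finset.card_image_of_injective _ hr]
  congr 1
  ext a
  simp only [Finset.mem_image, Finset.mem_filter, Finset.mem_univ, true_and, Multiset.mem_toFinset,
    mem_roots hl0]
  constructor
  · rintro ⟨x, hx, rfl⟩; exact hx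
  · intro ha
    have : a ∈ f.roots := Multiset.mem_of_le (roots.le_of_dvd hf0 hl) ((mem_roots hl0).2 ha)
    rw [hroots, Multiset.mem_map] at this
    obtain ⟨x, -, rfl⟩ := this
    exact ⟨x, ha, rfl⟩

end Roots

/-! ### Cycle types of Frobenius automorphisms -/

section FrobeniusCycles

namespace ModPoly

/-- The polynomial `dodecic s₀` modulo `p`. -/
def natBranch (p s₀ : ℕ) : ModPoly :=
  add p (ofInt p BiExpr.coeffsS)
    (add p (smul p (2 * (p - 1) * s₀) (ofInt p BiExpr.coeffsA)) [s₀ ^ 2])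

/-- The residue of `x ^ d` modulo the monic polynomial of degree `d` with lower coefficients `l`. -/
def topResidue (p : ℕ) (l : ModPoly) : ModPoly := smul p (p - 1) l

/-- Checks that `v` inverts the derivative of `dodecic s₀` modulo itself. -/
def isSeparable (p s₀ : ℕ) (v : ModPoly) : Bool :=
  let f := natBranch p s₀
  let l := f.take 12
  Nat.beq l.length 12 && isZero (sub p f (monic l)) &&
    isZero (sub p (mulMod p 12 (topResidue p l) v (deriv p f)) [1])

/-- Checks that `x ^ p ^ n = x` modulo `monic l`. -/
def isFixed (p n : ℕ) (l : ModPoly) : Bool :=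
  l.isEmpty ||
    let q := topResidue p l
    isZero (mulMod p l.length q (sub p (frobMod p l.length q n) [0, 1]) [1])

/-- Checks that `v` inverts `x ^ p ^ n - x` modulo `monic l`. -/
def isMoved (p n : ℕ) (l v : ModPoly) : Bool :=
  let q := topResidue p l
  isZero (sub p (mulMod p l.length q v (sub p (frobMod p l.length q n) [0, 1])) [1])

/-- Checks that `dodecic s₀` is the product of `monic l` and `monic h`. -/
def isFactorization (p s₀ : ℕ) (l h : ModPoly) : Bool :=
  isZero (sub p (natBranch p s₀) (mul p (monic l) (monic h)))

section

variable {R : Type*} [CommRing R] {p : ℕ} [Fact p.Prime] [CharP R p]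

theorem eval_natBranch (x : R) (s₀ : ℕ) : eval x (natBranch p s₀) = branch (s₀ : R) x := by
  rw [natBranch, eval_add, eval_add, eval_smul, eval_ofInt, eval_ofInt, branch]
  push_cast [Nat.cast_sub (Fact.out : p.Prime).one_le, CharP.cast_eq_zero]
  simp only [eval]
  push_cast
  ring

theorem pow_eq_eval_topResidue {x : R} {l : ModPoly} (h : eval x (monic l) = 0) :
    x ^ l.length = eval x (topResidue p l) := by
  rw [eval_monic] at h
  rw [topResidue, eval_smul]
  push_cast [Nat.cast_sub (Fact.out : p.Prime).one_le, CharP.cast_eq_zero]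
  linear_combination h

theorem eval_eq_of_isZero_sub {x : R} {k l : ModPoly} (h : isZero (sub p k l) = true) :
    eval x k = eval x l := by
  rw [← sub_eq_zero, ← eval_sub p]
  exact eval_eq_zero x h

theorem eval_derivative_ne_zero [Nontrivial R] {s₀ : ℕ} {v : ModPoly}
    (h : isSeparable p s₀ v = true) {x : R} (hx : branch (s₀ : R) x = 0) :
    (derivative (dodecic (s₀ : R))).eval x ≠ 0 := by
  simp only [isSeparable, Bool.and_eq_true] at h
  obtain ⟨⟨h12, hf⟩, hv⟩ := h
  have hd : dodecic (s₀ : R) = eval X (natBranch p s₀) := by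
    rw [eval_natBranch, dodecic, C_eq_natCast]
  rw [hd, derivative_eval_X p, ← coe_evalRingHom, map_eval, coe_evalRingHom, eval_X]
  intro h0
  have hx' : x ^ 12 = eval x (topResidue p ((natBranch p s₀).take 12)) := by
    rw [← pow_eq_eval_topResidue, Nat.eq_of_beq_eq_true h12]
    rw [← eval_eq_of_isZero_sub hf, eval_natBranch, hx]
  have := eval_eq_of_isZero_sub (x := x) hv
  rw [eval_mulMod p x hx', h0] at this
  simp [eval] at this

theorem pow_eq_self_of_isFixed [Nontrivial R] {n : ℕ} {l : ModPoly} (h : isFixed p n l = true)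
    {x : R} (hx : eval x (monic l) = 0) : x ^ p ^ n = x := by
  rw [isFixed, Bool.or_eq_true] at h
  obtain h | h := h
  · rw [List.isEmpty_iff] at h
    subst h
    simp [monic, eval] at hx
  · have hq := pow_eq_eval_topResidue (p := p) hx
    have := eval_eq_zero x h
    rw [eval_mulMod p x hq, eval_sub, eval_frobMod p x hq] at this
    simpa [eval, sub_eq_zero] using this

theorem pow_ne_self_of_isMoved [Nontrivial R] {n : ℕ} {l v : ModPoly}
    (h : isMoved p n l v = true) {x : R} (hx : eval x (monic l) = 0) : x ^ p ^ n ≠ x := by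
  intro h0
  have hq := pow_eq_eval_topResidue (p := p) hx
  have := eval_eq_of_isZero_sub (x := x) h
  rw [eval_mulMod p x hq, eval_sub, eval_frobMod p x hq, h0] at this
  simp [eval] at this

theorem branch_eq_mul_of_isFactorization {s₀ : ℕ} {l h : ModPoly}
    (hf : isFactorization p s₀ l h = true) (x : R) :
    branch (s₀ : R) x = eval x (monic l) * eval x (monic h) := by
  rw [← eval_natBranch (p := p), eval_eq_of_isZero_sub hf, eval_mul]

end

section

variable {G α k : Type*} [Group G] [MulAction G α] [Field k] {p : ℕ} [Fact p.Prime]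
  [CharP k p] {σ : G} {r : α → k}

omit [Fact p.Prime] [CharP k p] in
theorem pow_smul_eq (hr : ∀ x, r (σ • x) = r x ^ p) (n : ℕ) (x : α) :
    r (σ ^ n • x) = r x ^ p ^ n := by
  induction n with
  | zero => simp
  | succ n ih => rw [pow_succ', mul_smul, hr, ih, pow_succ, pow_mul]

theorem pow_smul_eq_self (hinj : Function.Injective r) (hr : ∀ x, r (σ • x) = r x ^ p) {n : ℕ}
    {l : ModPoly} (h : isFixed p n l = true) {x : α} (hx : eval (r x) (monic l) = 0) :
    σ ^ n • x = x :=
  hinj ((pow_smul_eq hr n x).trans (pow_eq_self_of_isFixed h hx))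

theorem dvd_minimalPeriod (hinj : Function.Injective r) (hr : ∀ x, r (σ • x) = r x ^ p)
    {e q a b : ℕ} (hq : q.Prime) {l v : ModPoly} (h : isFixed p (e * q ^ b) l = true)
    (h' : isMoved p (e * q ^ a) l v = true) {x : α} (hx : eval (r x) (monic l) = 0) :
    q ^ (a + 1) ∣ Function.minimalPeriod (σ ^ e • ·) x := by
  have key : ∀ n, Function.minimalPeriod (σ ^ e • ·) x ∣ n ↔ σ ^ (e * n) • x = x := by
    intro n
    rw [← Function.isPeriodicPt_iff_minimalPeriod_dvd, pow_mul, Function.IsPeriodicPt,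
      Function.IsFixedPt, smul_iterate_apply]
  obtain ⟨j, -, hj⟩ := (Nat.dvd_prime_pow hq).1 ((key _).2 (pow_smul_eq_self hinj hr h hx))
  rw [hj]
  refine pow_dvd_pow _ (Nat.succ_le_of_lt (lt_of_not_ge fun hle => ?_))
  have h1 := (key (q ^ a)).1 (hj ▸ pow_dvd_pow _ hle)
  refine pow_ne_self_of_isMoved h' hx ?_
  rw [← pow_smul_eq hr, h1]

variable [Fintype α] {s₀ : ℕ} {l h : ModPoly}

theorem card_filter_eval_monic [DecidableEq k] (hinj : Function.Injective r)
    (hprod : dodecic (s₀ : k) = ∏ x, (X - C (r x))) (hf : isFactorization p s₀ l h = true) :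
    (Finset.univ.filter fun x => eval (r x) (monic l) = 0).card = l.length := by
  have hdvd : eval X (monic l) ∣ dodecic (s₀ : k) := by
    rw [dodecic, C_eq_natCast, branch_eq_mul_of_isFactorization hf]
    exact dvd_mul_right _ _
  have := card_filter_eval_eq_zero hinj hprod hdvd
  rw [natDegree_eval_X_monic] at this
  rw [← this]
  congr 2
  funext x
  rw [← coe_evalRingHom, map_eval, coe_evalRingHom, eval_X]

theorem eval_monic_eq_zero_or (hprod : dodecic (s₀ : k) = ∏ x, (X - C (r x)))
    (hf : isFactorization p s₀ l h = true) (x : α) :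
    eval (r x) (monic l) = 0 ∨ eval (r x) (monic h) = 0 := by
  rw [← mul_eq_zero, ← branch_eq_mul_of_isFactorization hf, ← eval_dodecic, hprod, eval_prod]
  exact Finset.prod_eq_zero (Finset.mem_univ x) (by simp)

theorem hasCycles (hinj : Function.Injective r) (hr : ∀ x, r (σ • x) = r x ^ p)
    (hprod : dodecic (s₀ : k) = ∏ x, (X - C (r x))) (hf : isFactorization p s₀ l h = true)
    {e q a b : ℕ} (hq : q.Prime) (hl : isFixed p e l = true)
    (hh : isFixed p (e * q ^ b) h = true) {v : ModPoly}
    (hm : isMoved p (e * q ^ a) h v = true) : HasCycles G α l.length (q ^ (a + 1)) := by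
  classical
  refine ⟨σ ^ e, _, card_filter_eval_monic hinj hprod hf, fun x hx => ?_, fun x hx => ?_⟩
  · exact pow_smul_eq_self hinj hr hl (Finset.mem_filter.1 hx).2
  · refine dvd_minimalPeriod hinj hr hq hh hm ((eval_monic_eq_zero_or hprod hf x).resolve_left ?_)
    simpa using hx

end

end ModPoly

end FrobeniusCycles

section StabilizerCycles

universe u

open ModPoly

variable {Ω : Type u} [Field Ω] [Algebra (RatFunc ℚ) Ω] [FiniteDimensional (RatFunc ℚ) Ω]
  [IsGalois (RatFunc ℚ) Ω] {s : Ω} [Fintype (RootSet s)]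

/-- A Frobenius automorphism at a place given by natural numbers. -/
theorem exists_natCast_frobenius
    (hs : s ^ 2 = algebraMap (RatFunc ℚ) Ω ((scale : RatFunc ℚ) * (RatFunc.X - 1)))
    (hτ : ∃ τ : Ω ≃ₐ[RatFunc ℚ] Ω, τ s = -s) (hsplit : (dodecic s).Splits)
    (p s₀ : ℕ) [Fact p.Prime] (v : ModPoly)
    (h : (¬ p ∣ s₀ ∧ ¬ p ∣ 2 ∧ ¬ (p : ℤ) ∣ scale) ∧
      isSeparable p s₀ v = true) :
    ∃ (k : Type u) (_ : Field k) (_ : CharP k p)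
      (σ : MulAction.stabilizer (Ω ≃ₐ[RatFunc ℚ] Ω) s) (r : RootSet s → k),
      Function.Injective r ∧ dodecic (s₀ : k) = ∏ x, (X - C (r x)) ∧
      ∀ x, r (σ • x) = r x ^ p := by
  obtain ⟨τ, hτ⟩ := hτ
  obtain ⟨⟨h0, h2, hsc⟩, hsep⟩ := h
  obtain ⟨k, _, _, σ, r, hr⟩ := exists_frobenius hs τ hτ hsplit (s₀ : ZMod p)
    (fun h => h0 ((ZMod.natCast_eq_zero_iff _ _).1 h))
    (fun h => h2 ((ZMod.natCast_eq_zero_iff _ _).1 (by exact_mod_cast h)))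
    (fun h => hsc ((ZMod.intCast_zmod_eq_zero_iff_dvd _ _).1 h))
    (fun k _ _ a ha => by
      have : CharP k p := charP_of_injective_algebraMap (algebraMap (ZMod p) k).injective p
      rw [map_natCast] at ha ⊢
      exact eval_derivative_ne_zero hsep ha)
  rw [map_natCast] at hr
  exact ⟨k, inferInstance, charP_of_injective_algebraMap (algebraMap (ZMod p) k).injective p,
    σ, r, hr⟩

/-- Cycle types realised by automorphisms fixing `s`. -/
theorem stabilizer_hasCycles
    (hs : s ^ 2 = algebraMap (RatFunc ℚ) Ω ((scale : RatFunc ℚ) * (RatFunc.X - 1)))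
    (hτ : ∃ τ : Ω ≃ₐ[RatFunc ℚ] Ω, τ s = -s) (hsplit : (dodecic s).Splits) :
    let H := MulAction.stabilizer (Ω ≃ₐ[RatFunc ℚ] Ω) s
    let Z := RootSet s
    (HasCycles H Z 0 2 ∧ HasCycles H Z 1 11 ∧ HasCycles H Z 2 5 ∧ HasCycles H Z 3 3) ∧
      HasCycles H Z 2 2 ∧ HasCycles H Z 4 4 ∧
      ∃ g : H, ∃ F : Finset Z, F.card = 2 ∧ (∀ x ∈ F, g • x = x) ∧
        ∃ x : Z, 8 ∣ Function.minimalPeriod (g • ·) x := by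
  classical
  have : Fact (Nat.Prime 5) := ⟨by norm_num⟩
  have : Fact (Nat.Prime 7) := ⟨by norm_num⟩
  have : Fact (Nat.Prime 13) := ⟨by norm_num⟩
  have : Fact (Nat.Prime 23) := ⟨by norm_num⟩
  refine ⟨⟨?_, ?_, ?_, ?_⟩, ?_⟩
  · obtain ⟨k, _, _, σ, r, hinj, hprod, hr⟩ := exists_natCast_frobenius hs hτ hsplit 5 1
      [1, 0, 0, 3, 2, 4, 4, 1, 0, 1, 0, 3] (by decide +kernel)
    exact hasCycles (l := []) (h := [3, 3, 4, 3, 4, 3, 2, 3, 4, 3, 1, 0]) (e := 1) (q := 2)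
      (a := 0) (b := 3) (v := [3, 1, 1, 1, 0, 3, 0, 3, 0, 3, 4]) hinj hr hprod
      (by decide +kernel) (by norm_num) (by decide +kernel) (by decide +kernel) (by decide +kernel)
  · obtain ⟨k, _, _, σ, r, hinj, hprod, hr⟩ := exists_natCast_frobenius hs hτ hsplit 7 2
      [4, 1, 1, 6, 1, 1, 6, 4, 6, 6, 6, 6] (by decide +kernel)
    exact hasCycles (l := [2]) (h := [4, 5, 1, 5, 0, 3, 4, 2, 1, 1, 5]) (e := 1) (q := 11)
      (a := 0) (b := 1) (v := [6, 3, 1, 1, 6, 2, 2, 2, 1, 4, 5]) hinj hr hprod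
      (by decide +kernel) (by norm_num) (by decide +kernel) (by decide +kernel) (by decide +kernel)
  · obtain ⟨k, _, _, σ, r, hinj, hprod, hr⟩ := exists_natCast_frobenius hs hτ hsplit 23 1
      [5, 13, 5, 6, 2, 3, 5, 6, 0, 21, 22, 5] (by decide +kernel)
    exact hasCycles (l := [4, 11]) (h := [8, 6, 13, 3, 1, 4, 5, 7, 7, 12]) (e := 1) (q := 5)
      (a := 0) (b := 1) (v := [15, 18, 4, 22, 21, 6, 12, 17, 5, 13]) hinj hr hprod
      (by decide +kernel) (by norm_num) (by decide +kernel) (by decide +kernel) (by decide +kernel)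
  · obtain ⟨k, _, _, σ, r, hinj, hprod, hr⟩ := exists_natCast_frobenius hs hτ hsplit 13 1
      [10, 2, 8, 2, 9, 11, 0, 4, 10, 2, 7, 3] (by decide +kernel)
    exact hasCycles (l := [7, 6, 10]) (h := [7, 0, 4, 2, 6, 3, 6, 9, 3]) (e := 2) (q := 3)
      (a := 0) (b := 1) (v := [8, 11, 4, 5, 8, 1, 5, 6, 2]) hinj hr hprod
      (by decide +kernel) (by norm_num) (by decide +kernel) (by decide +kernel) (by decide +kernel)
  · obtain ⟨k, _, _, σ, r, hinj, hprod, hr⟩ := exists_natCast_frobenius hs hτ hsplit 5 4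
      [4, 1, 0, 2, 3, 2, 1, 3, 2, 1, 1, 4] (by decide +kernel)
    have h2 : isFactorization 5 4 [0, 1] [4, 3, 2, 2, 1, 0, 3, 1, 2, 4] = true := by decide +kernel
    have h8 : isFactorization 5 4 [2, 4, 0, 4, 3, 3, 0, 4] [0, 2, 2, 1] = true := by decide +kernel
    refine ⟨?_, ?_, σ, Finset.univ.filter fun x => ModPoly.eval (r x) (monic [0, 1]) = 0,
      card_filter_eval_monic hinj hprod h2, fun x hx => ?_, ?_⟩
    · exact hasCycles (e := 1) (q := 2)
        (a := 0) (b := 3) (v := [3, 3, 1, 3, 1, 1, 0, 2, 0, 4]) hinj hr hprod h2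
        (by norm_num) (by decide +kernel) (by decide +kernel) (by decide +kernel)
    · exact hasCycles (l := [0, 2, 2, 1]) (h := [2, 4, 0, 4, 3, 3, 0, 4]) (e := 2) (q := 2)
        (a := 1) (b := 2) (v := [2, 2, 2, 3, 3, 3, 1, 3]) hinj hr hprod (by decide +kernel)
        (by norm_num) (by decide +kernel) (by decide +kernel) (by decide +kernel)
    · rw [← pow_one σ]
      exact pow_smul_eq_self (n := 1) (l := [0, 1]) hinj hr (by decide +kernel)
        (Finset.mem_filter.1 hx).2
    · have hcard := card_filter_eval_monic hinj hprod h8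
      obtain ⟨x, hx⟩ := Finset.card_pos.1 (hcard.trans_gt (Nat.succ_pos 7))
      refine ⟨x, ?_⟩
      rw [← pow_one σ]
      exact dvd_minimalPeriod (e := 1) (q := 2) (a := 2) (b := 3)
        (l := [2, 4, 0, 4, 3, 3, 0, 4]) (v := [2, 2, 2, 3, 3, 3, 1, 3]) hinj hr (by norm_num)
        (by decide +kernel) (by decide +kernel) (Finset.mem_filter.1 hx).2

end StabilizerCycles

/-! ### The hexads of a Steiner system -/

section Hexads

/-- The data of a pair of roots of `dodecic (-s)` reduced modulo `2203`: the indices of the roots,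
the coordinates of the point on the curve, the ratio of the two sextics up to sign, and the set of the
roots of `dodecic s` at which the sign is negative. -/
structure PairDatum where
  i : Fin 12
  j : Fin 12
  m : ℕ
  r : ℕ
  c : ℕ
  mask : ℕ

namespace PairDatum

/-- Whether two roots lie in the same part of the partition attached to a pair. -/
def same (d : PairDatum) (a b : Fin 12) : Bool := d.mask.testBit a == d.mask.testBit b

/-- The list of all pairs at the place `s = 611`. -/
def list : List PairDatum :=
  [⟨0, 1, 66, 277, 1700, 4032⟩, ⟨0, 2, 870, 2010, 652, 2858⟩, ⟨0, 3, 1947, 600, 1551, 2676⟩,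
  ⟨0, 4, 831, 1480, 1877, 2454⟩, ⟨0, 5, 344, 1084, 1228, 1394⟩, ⟨0, 6, 1487, 621, 509, 3256⟩,
  ⟨0, 7, 1208, 1906, 900, 1702⟩, ⟨0, 8, 607, 612, 712, 3150⟩, ⟨0, 9, 374, 307, 1987, 492⟩,
  ⟨0, 10, 1312, 205, 1849, 730⟩, ⟨0, 11, 572, 911, 2105, 1820⟩, ⟨1, 2, 560, 2066, 1987, 1258⟩,
  ⟨1, 3, 328, 656, 368, 1460⟩, ⟨1, 4, 1167, 1536, 1605, 1622⟩, ⟨1, 5, 1640, 1140, 891, 2738⟩,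
  ⟨1, 6, 2143, 677, 94, 888⟩, ⟨1, 7, 1997, 1962, 627, 2406⟩, ⟨1, 8, 1992, 668, 1849, 910⟩,
  ⟨1, 9, 434, 363, 2151, 3628⟩, ⟨1, 10, 1861, 261, 497, 3354⟩, ⟨1, 11, 1205, 967, 1102, 2268⟩,
  ⟨2, 3, 1127, 186, 610, 350⟩, ⟨2, 4, 1511, 1066, 89, 700⟩, ⟨2, 5, 1342, 670, 345, 3672⟩,
  ⟨2, 6, 1235, 207, 1010, 1938⟩, ⟨2, 7, 1890, 1492, 1179, 3468⟩, ⟨2, 8, 306, 198, 987, 1892⟩,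
  ⟨2, 9, 556, 2096, 1752, 2758⟩, ⟨2, 10, 32, 1994, 1306, 2544⟩, ⟨2, 11, 1602, 497, 880, 3126⟩,
  ⟨3, 4, 220, 1859, 541, 994⟩, ⟨3, 5, 1177, 1463, 1249, 3846⟩, ⟨3, 6, 303, 1000, 851, 1740⟩,
  ⟨3, 7, 175, 82, 1915, 3282⟩, ⟨3, 8, 1585, 991, 696, 1594⟩, ⟨3, 9, 1816, 686, 1701, 2968⟩,
  ⟨3, 10, 428, 584, 1465, 2222⟩, ⟨3, 11, 34, 1290, 1285, 3432⟩, ⟨4, 5, 1143, 140, 2003, 3300⟩,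
  ⟨4, 6, 2022, 1880, 386, 1326⟩, ⟨4, 7, 821, 962, 1313, 3888⟩, ⟨4, 8, 929, 1871, 1896, 1496⟩,
  ⟨4, 9, 1271, 1566, 1254, 2170⟩, ⟨4, 10, 1200, 1464, 1623, 2892⟩, ⟨4, 11, 607, 2170, 198, 3722⟩,
  ⟨5, 6, 1034, 1484, 285, 2506⟩, ⟨5, 7, 434, 566, 1476, 980⟩, ⟨5, 8, 112, 1475, 625, 2364⟩,
  ⟨5, 9, 321, 1170, 479, 1182⟩, ⟨5, 10, 628, 1068, 51, 1960⟩, ⟨5, 11, 2070, 1774, 1236, 622⟩,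
  ⟨6, 7, 1955, 103, 1852, 2590⟩, ⟨6, 8, 975, 1012, 465, 246⟩, ⟨6, 9, 1017, 707, 2051, 3412⟩,
  ⟨6, 10, 999, 605, 525, 3682⟩, ⟨6, 11, 1591, 1311, 2066, 2980⟩, ⟨7, 8, 1942, 94, 184, 2792⟩,
  ⟨7, 9, 487, 1992, 2169, 1866⟩, ⟨7, 10, 1152, 1890, 236, 1148⟩, ⟨7, 11, 464, 393, 75, 442⟩,
  ⟨8, 9, 2051, 698, 1306, 3490⟩, ⟨8, 10, 295, 596, 1867, 3732⟩, ⟨8, 11, 305, 1302, 355, 2898⟩,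
  ⟨9, 10, 1100, 291, 1461, 822⟩, ⟨9, 11, 2145, 997, 22, 1776⟩, ⟨10, 11, 115, 895, 261, 1478⟩]

/-- Whether all elements of a list lie in one part of some partition. -/
def coherent (l : List (Fin 12)) : Bool :=
  list.any fun d => l.all fun a => l.all fun b => d.same a b

/-- The four-element subsets of the first hexad. -/
def quads : List (List (Fin 12)) := List.sublistsLen 4 [0, 1, 2, 3, 4, 5]

/-- A permutation of the twelve points compatible with the partitions. -/
def IsSymmetry (α : Equiv.Perm (Fin 12)) : Prop :=
  ∀ d ∈ list, ∃ d' ∈ list, ∀ a b, d.same a b = d'.same (α a) (α b)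

theorem coherent_map {α : Equiv.Perm (Fin 12)} (h : IsSymmetry α) {l : List (Fin 12)}
    (hl : coherent l = true) : coherent (l.map α) = true := by
  simp only [coherent, List.any_eq_true, List.all_eq_true] at hl ⊢
  obtain ⟨d, hd, hl⟩ := hl
  obtain ⟨d', hd', hs⟩ := h d hd
  refine ⟨d', hd', fun a ha b hb => ?_⟩
  obtain ⟨a', ha', rfl⟩ := List.mem_map.1 ha
  obtain ⟨b', hb', rfl⟩ := List.mem_map.1 hb
  rw [← hs]
  exact hl a' ha' b' hb'

theorem le_of_coherent : ∀ z : Fin 12, coherent [0, 1, 2, 3, 4, z] = true → z ≤ 5 := by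
  decide +kernel

theorem coherent_base : coherent [0, 1, 2, 3, 4, 5] = true := by decide +kernel

theorem exists_distinguishing : ∀ z : Fin 12, 6 < z → ∃ y : Fin 12, 6 < y ∧ ∀ y' : Fin 12, 5 < y' →
    y' ≠ z →
      (quads.any fun q => (coherent (q ++ [6, y])) && !(coherent (q ++ [z, y']))) = true := by
  decide +kernel

theorem distinguishing : ∀ y y' : Fin 12, 6 < y → 6 < y' → y' ≠ y →
    (quads.any fun q => (coherent (q ++ [6, y])) && !(coherent (q ++ [6, y']))) = true := by
  decide +kernel

theorem le_of_mem_quads : ∀ q ∈ quads, ∀ a ∈ q, a ≤ 5 := by decide +kernel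

/-- A symmetry fixing the first five points is trivial. -/
theorem IsSymmetry.eq_one {α : Equiv.Perm (Fin 12)} (h : IsSymmetry α)
    (h5 : ∀ a < 5, α a = a) : α = 1 := by
  have hlt : ∀ {n : Fin 12}, (∀ a < n, α a = a) → ∀ z, n ≤ z → n ≤ α z := by
    intro n hn z hz
    by_contra hlt
    have h1 := α.injective (hn _ (not_le.1 hlt))
    exact hlt (h1.symm ▸ hz)
  have key : ∀ q ∈ quads, (∀ a < (6 : Fin 12), α a = a) → ∀ x y,
      coherent (q ++ [x, y]) = true → coherent (q ++ [α x, α y]) = true := by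
    intro q hq h6 x y hxy
    have := coherent_map h hxy
    rw [List.map_append, List.map_congr_left (g := id), List.map_id] at this
    · exact this
    · exact fun a ha => h6 a (lt_of_le_of_lt (le_of_mem_quads q hq a ha) (by decide))
  have hex : ∀ {u v x y : Fin 12}, (∀ a < (6 : Fin 12), α a = a) → α x = u → α y = v →
      (quads.any fun q => (coherent (q ++ [x, y])) && !(coherent (q ++ [u, v]))) = true →
      False := by
    rintro _ _ x y h6 rfl rfl hany
    simp only [List.any_eq_true, Bool.and_eq_true, Bool.not_eq_true'] at hany
    obtain ⟨q, hq, h1, h2⟩ := hany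
    rw [key q hq h6 x y h1] at h2
    exact absurd h2 (by decide)
  have ext : ∀ {n m : Fin 12}, (∀ a < n, α a = a) → (∀ a < m, a < n ∨ a = n) → α n = n →
      ∀ a < m, α a = a := by
    intro n m hn hm he a ha
    rcases hm a ha with h | rfl
    exacts [hn a h, he]
  have h6 : ∀ a < (6 : Fin 12), α a = a := by
    refine ext h5 (by decide) (le_antisymm (le_of_coherent _ ?_) (hlt h5 5 le_rfl))
    have := coherent_map h coherent_base
    simpa only [List.map_cons, List.map_nil, h5 0 (by decide), h5 1 (by decide), h5 2 (by decide),
      h5 3 (by decide), h5 4 (by decide)] using this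
  have h7 : ∀ a < (7 : Fin 12), α a = a := by
    refine ext h6 (by decide) ?_
    by_contra hne
    have hz : 6 < α 6 := lt_of_le_of_ne (hlt h6 6 le_rfl) (Ne.symm hne)
    obtain ⟨y, hy, hy'⟩ := exists_distinguishing _ hz
    exact hex h6 rfl rfl (hy' (α y) (lt_of_lt_of_le (by decide) (hlt h6 y hy.le))
      fun h => hy.ne' (α.injective h))
  ext1 y
  by_contra hne
  have hy : 6 < y := by
    by_contra hle
    exact hne (h7 y (lt_of_le_of_lt (not_lt.1 hle) (by decide)))
  have hy7 : (7 : Fin 12) ≤ y := by clear hne; revert y; decide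
  exact hex h6 (h7 6 (by decide)) rfl
    (distinguishing y (α y) hy (lt_of_lt_of_le (by decide) (hlt h7 y hy7)) hne)

theorem eq_of_same : ∀ d ∈ list, ∀ d' ∈ list, (∀ a b, d.same a b = d'.same a b) →
    d.i = d'.i ∧ d.j = d'.j := by
  have h : (list.all fun d => list.all fun d' => (decide (d.i = d'.i ∧ d.j = d'.j)) ||
      !(List.finRange 12).all fun a => d.same a 0 == d'.same a 0) = true := by decide +kernel
  simp only [List.all_eq_true, Bool.or_eq_true, decide_eq_true_eq] at h
  intro d hd d' hd' hs
  refine (h d hd d' hd').resolve_right ?_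
  simp [hs]

end PairDatum

end Hexads

/-! ### The point attached to a pair of roots -/

section Pairs

open BiExpr

/-- The coefficients of the quartic in the norm form of the dodecic. -/
def coeffsG : List ℤ := [2152241, -91036, -23255, 324, 24]

theorem evalList_coeffsS {R : Type*} [CommRing R] (x : R) :
    evalList x coeffsS =
      evalList x coeffsA ^ 2 + 16 * evalList x coeffsG ^ 2 * ((x - 20) ^ 2 + 4) := by
  simp only [evalList, coeffsS, coeffsA, coeffsG]
  push_cast
  ring

theorem exists_param_identity {R : Type*} [CommRing R] (m r x : R) : ∃ q : R,
    (1 + m ^ 2) ^ 3 * (evalList x coeffsA +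
        4 * evalList x coeffsG * (m * (x - 20) + (1 + m ^ 2) * r)) =
      paramNum.eval m r - 2 * (1 + m ^ 2) * curve.eval m r * (x - 20) +
      q * ((m * (x - 20) + (1 + m ^ 2) * r) ^ 2 + (x - 20) ^ 2 + 4) := by
  obtain ⟨z, rfl⟩ : ∃ z, x = z + 20 := ⟨x - 20, by ring⟩
  obtain ⟨k, hk⟩ : ∃ k, k = 1 + m ^ 2 := ⟨_, rfl⟩
  have hsub : z + 20 - 20 = z := by ring
  rw [hsub, ← hk]
  obtain ⟨v, hv⟩ : ∃ v, v = k ^ 2 * r ^ 2 + 4 := ⟨_, rfl⟩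
  obtain ⟨b5, h5⟩ : ∃ b, b = 120 + 96 * m := ⟨_, rfl⟩
  obtain ⟨b4, h4⟩ : ∃ b, b = 1590 + 8976 * m + 96 * k * r := ⟨_, rfl⟩
  obtain ⟨b3, h3⟩ : ∃ b, b = -146492 + 215140 * m + 8976 * k * r := ⟨_, rfl⟩
  obtain ⟨b2, h2⟩ : ∃ b, b = -3457863 + 542256 * m + 215140 * k * r := ⟨_, rfl⟩
  obtain ⟨e5, he5⟩ : ∃ e, e = b5 - 2 * m * r := ⟨_, rfl⟩
  obtain ⟨e4, he4⟩ : ∃ e, e = k * b4 - 2 * m * r * k * e5 - v := ⟨_, rfl⟩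
  obtain ⟨e3, he3⟩ : ∃ e, e = k * b3 - 2 * m * r * e4 - v * e5 := ⟨_, rfl⟩
  obtain ⟨e2, he2⟩ : ∃ e, e = k ^ 2 * b2 - 2 * m * r * k * e3 - v * e4 := ⟨_, rfl⟩
  refine ⟨k ^ 2 * z ^ 4 + k ^ 2 * e5 * z ^ 3 + k * e4 * z ^ 2 + k * e3 * z + e2, ?_⟩
  have hc : 2 * k * curve.eval m r = 2 * m * k * r * e2 + v * k * e3 -
      k ^ 3 * (-12633516 - 10153916 * m + 542256 * k * r) := by
    subst he2 he3 he4 he5 h2 h3 h4 h5 hv hk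
    simp only [curve, ofRows, ofCoeffs, BiExpr.pow, kappa, BiExpr.eval]
    push_cast
    ring
  have hp : paramNum.eval m r = k ^ 3 * (-6994942 - 10153916 * k * r) - v * e2 := by
    subst he2 he3 he4 he5 h2 h3 h4 h5 hv hk
    simp only [paramNum, ofRows, ofCoeffs, BiExpr.pow, BiExpr.eval]
    push_cast
    ring
  have hq : (m * z + k * r) ^ 2 + z ^ 2 + 4 = k * z ^ 2 + 2 * m * k * r * z + v := by
    rw [hv, hk]; ring
  rw [hc, hp, hq]
  simp only [evalList, coeffsA, coeffsG]
  push_cast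
  linear_combination (-k^3 * z^5) * he5 - k^2 * z^4 * he4 - k^2 * z^3 * he3 - k * z^2 * he2
    - k ^ 3 * (z ^ 5 * h5 + z ^ 4 * h4 + z ^ 3 * h3 + z ^ 2 * h2)

/-- The coordinates `m` and `r` of the point attached to the pair of roots `y₁` and `y₂`. -/
def IsPair {R : Type*} [CommRing R] (s y₁ y₂ m r : R) : Prop :=
  ∃ w₁ w₂, 4 * evalList y₁ coeffsG * w₁ = -(s + evalList y₁ coeffsA) ∧
    4 * evalList y₂ coeffsG * w₂ = -(s + evalList y₂ coeffsA) ∧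
    m * (y₁ - y₂) = w₁ - w₂ ∧ (1 + m ^ 2) * r = w₁ - m * (y₁ - 20)

/-- The relation between roots of `dodecic s` defined by a pair of roots of `dodecic (-s)`. -/
def PairRel {R : Type*} [CommRing R] (s y₁ y₂ x x' : R) : Prop :=
  ∃ m r, IsPair s y₁ y₂ m r ∧
    evalX m r x sexticEven * evalX m r x' sexticOdd =
      evalX m r x' sexticEven * evalX m r x sexticOdd

theorem BiExpr.map_evalX {R S : Type*} [CommRing R] [CommRing S] (f : R →+* S) (m r x : R)
    (l : List BiExpr) : f (evalX m r x l) = evalX (f m) (f r) (f x) l := by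
  induction l with
  | nil => simp [evalX]
  | cons a l ih => simp [evalX, ih, BiExpr.map_eval]

section

variable {R S : Type*} [CommRing R] [CommRing S] {s y₁ y₂ m r x x' : R}

theorem IsPair.map (h : IsPair s y₁ y₂ m r) (f : R →+* S) :
    IsPair (f s) (f y₁) (f y₂) (f m) (f r) := by
  obtain ⟨w₁, w₂, h1, h2, h3, h4⟩ := h
  refine ⟨f w₁, f w₂, ?_, ?_, ?_, ?_⟩
  · simpa [map_evalList, map_ofNat] using congrArg f h1
  · simpa [map_evalList, map_ofNat] using congrArg f h2
  · simpa [map_ofNat] using congrArg f h3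
  · simpa [map_ofNat] using congrArg f h4

theorem IsPair.symm (h : IsPair s y₁ y₂ m r) : IsPair s y₂ y₁ m r := by
  obtain ⟨w₁, w₂, h1, h2, h3, h4⟩ := h
  exact ⟨w₂, w₁, h2, h1, by linear_combination -h3, by linear_combination h4 - h3⟩

theorem PairRel.map (h : PairRel s y₁ y₂ x x') (f : R →+* S) :
    PairRel (f s) (f y₁) (f y₂) (f x) (f x') := by
  obtain ⟨m, r, h, he⟩ := h
  exact ⟨f m, f r, h.map f, by simpa [map_evalX] using congrArg f he⟩

theorem PairRel.symm (h : PairRel s y₁ y₂ x x') : PairRel s y₂ y₁ x x' := by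
  obtain ⟨m, r, h, he⟩ := h
  exact ⟨m, r, h.symm, he⟩

/-- The conditions under which a pair of roots has a unique point. -/
def Nondegenerate (y₁ y₂ m : R) : Prop :=
  4 * evalList y₁ coeffsG ≠ 0 ∧ 4 * evalList y₂ coeffsG ≠ 0 ∧ y₁ - y₂ ≠ 0 ∧ 1 + m ^ 2 ≠ 0

theorem Nondegenerate.of_map {f : R →+* S} (h : Nondegenerate (f y₁) (f y₂) (f m)) :
    Nondegenerate y₁ y₂ m := by
  obtain ⟨h1, h2, h3, h4⟩ := h
  refine ⟨fun h => h1 ?_, fun h => h2 ?_, fun h => h3 ?_, fun h => h4 ?_⟩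
  · simpa [map_evalList, map_ofNat] using congrArg f h
  · simpa [map_evalList, map_ofNat] using congrArg f h
  · simpa [map_ofNat] using congrArg f h
  · simpa [map_ofNat] using congrArg f h

theorem Nondegenerate.map {f : R →+* S} (hf : Function.Injective f) (h : Nondegenerate y₁ y₂ m) :
    Nondegenerate (f y₁) (f y₂) (f m) := by
  obtain ⟨h1, h2, h3, h4⟩ := h
  refine ⟨fun h => h1 (hf ?_), fun h => h2 (hf ?_), fun h => h3 (hf ?_), fun h => h4 (hf ?_)⟩
  · simpa [map_evalList, map_ofNat] using h
  · simpa [map_evalList, map_ofNat] using h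
  · simpa [map_ofNat] using h
  · simpa [map_ofNat] using h

theorem IsPair.unique [IsDomain R] {m' r' : R} (h : IsPair s y₁ y₂ m r) (hn : Nondegenerate y₁ y₂ m)
    (h' : IsPair s y₁ y₂ m' r') : m' = m ∧ r' = r := by
  obtain ⟨w₁, w₂, h1, h2, h3, h4⟩ := h
  obtain ⟨w₁', w₂', h1', h2', h3', h4'⟩ := h'
  obtain ⟨n1, n2, n3, n4⟩ := hn
  obtain rfl : w₁' = w₁ := mul_left_cancel₀ n1 (h1'.trans h1.symm)
  obtain rfl : w₂' = w₂ := mul_left_cancel₀ n2 (h2'.trans h2.symm)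
  obtain rfl : m' = m := mul_right_cancel₀ n3 (h3'.trans h3.symm)
  exact ⟨rfl, mul_left_cancel₀ n4 (h4'.trans h4.symm)⟩

theorem IsPair.sextic_sq [IsDomain R] (h : IsPair s y₁ y₂ m r) (hn : Nondegenerate y₁ y₂ m)
    (hy₁ : branch (-s) y₁ = 0) (hy₂ : branch (-s) y₂ = 0) (h0 : (2 : R) ≠ 0)
    (hx : branch s x = 0) :
    oddCoeff1.eval m r * evalX m r x sexticEven ^ 2 =
      (1 + m ^ 2) * normD.eval m r * evalX m r x sexticOdd ^ 2 := by
  obtain ⟨w₁, w₂, h1, h2, h3, h4⟩ := h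
  obtain ⟨n1, n2, n3, n4⟩ := hn
  have hw : ∀ y w : R, 4 * evalList y coeffsG * w = -(s + evalList y coeffsA) →
      4 * evalList y coeffsG ≠ 0 → branch (-s) y = 0 → w = m * (y - 20) + (1 + m ^ 2) * r →
      -(1 + m ^ 2) ^ 3 * s = paramNum.eval m r - 2 * (1 + m ^ 2) * curve.eval m r * (y - 20) := by
    intro y w h1 h2 h3 h4
    have hq : w ^ 2 + (y - 20) ^ 2 + 4 = 0 := by
      refine (mul_eq_zero.1 ?_).resolve_left (pow_ne_zero 2 h2)
      rw [branch, evalList_coeffsS] at h3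
      linear_combination h3 + (4 * evalList y coeffsG * w - (s + evalList y coeffsA)) * h1
    obtain ⟨q, hp⟩ := exists_param_identity m r y
    rw [← h4, hq] at hp
    linear_combination hp - (1 + m ^ 2) ^ 3 * h1
  have e1 := hw y₁ w₁ h1 n1 hy₁ (by linear_combination -h4)
  have e2 := hw y₂ w₂ h2 n2 hy₂ (by linear_combination -h4 + h3)
  have hc : curve.eval m r = 0 := by
    refine (mul_eq_zero.1 (?_ : (2 * (1 + m ^ 2) * (y₁ - y₂)) * _ = 0)).resolve_left
      (mul_ne_zero (mul_ne_zero h0 n4) n3)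
    linear_combination e1 - e2
  rw [hc] at e1
  rw [branch] at hx
  rw [sextic_identity x hc, evalX_map_const, evalX_map_const]
  have hp : paramNum.eval m r = -(1 + m ^ 2) ^ 3 * s := by linear_combination -e1
  rw [hp]
  linear_combination (oddCoeff1.eval m r * normD.eval m r ^ 2 * (1 + m ^ 2) ^ 6) * hx

end

section

variable {O k Ω : Type*} [CommRing O] [Field k] [Field Ω] {s y₁ y₂ x x' : O}

theorem exists_isPair_lift {π : O →+* k} (hπ : ∀ o, π o ≠ 0 → IsUnit o) {m₀ r₀ : k}
    (h : IsPair (π s) (π y₁) (π y₂) m₀ r₀) (hn : Nondegenerate (π y₁) (π y₂) m₀) :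
    ∃ m r, IsPair s y₁ y₂ m r ∧ π m = m₀ ∧ π r = r₀ := by
  have hn' := hn
  obtain ⟨n1, n2, n3, n4⟩ := hn
  have hdiv : ∀ a b : O, π a ≠ 0 → ∃ c, a * c = b := by
    intro a b ha
    obtain ⟨u, rfl⟩ := hπ a ha
    exact ⟨u⁻¹ * b, by simp⟩
  obtain ⟨w₁, h1⟩ := hdiv (4 * evalList y₁ coeffsG) (-(s + evalList y₁ coeffsA))
    (by simpa [map_evalList, map_ofNat] using n1)
  obtain ⟨w₂, h2⟩ := hdiv (4 * evalList y₂ coeffsG) (-(s + evalList y₂ coeffsA))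
    (by simpa [map_evalList, map_ofNat] using n2)
  obtain ⟨m, h3⟩ := hdiv (y₁ - y₂) (w₁ - w₂) (by simpa [map_ofNat] using n3)
  obtain ⟨v₁, v₂, e1, e2, e3, e4⟩ := h
  have hm : π m = m₀ := by
    have hv₁ : π w₁ = v₁ := by
      refine mul_left_cancel₀ n1 (Eq.trans ?_ e1.symm)
      simpa [map_evalList, map_ofNat] using congrArg π h1
    have hv₂ : π w₂ = v₂ := by
      refine mul_left_cancel₀ n2 (Eq.trans ?_ e2.symm)
      simpa [map_evalList, map_ofNat] using congrArg π h2
    refine mul_right_cancel₀ n3 (Eq.trans ?_ e3.symm)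
    rw [← hv₁, ← hv₂, ← map_sub, ← map_sub, ← map_mul, mul_comm, h3]
  obtain ⟨r, h4⟩ := hdiv (1 + m ^ 2) (w₁ - m * (y₁ - 20)) (by simpa [hm, map_ofNat] using n4)
  have hp : IsPair s y₁ y₂ m r := ⟨w₁, w₂, h1, h2, by rw [mul_comm, h3], h4⟩
  exact ⟨m, r, hp, hm, (IsPair.unique ⟨v₁, v₂, e1, e2, e3, e4⟩ hn' (hp.map π)).2⟩

/-- The relation attached to a pair of roots can be read off from its reduction. -/
theorem pairRel_iff {ι : O →+* Ω} (hι : Function.Injective ι) {π : O →+* k}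
    (hπ : ∀ o, π o ≠ 0 → IsUnit o) (h2 : (2 : k) ≠ 0) {m₀ r₀ c : k}
    (h : IsPair (π s) (π y₁) (π y₂) m₀ r₀) (hn : Nondegenerate (π y₁) (π y₂) m₀)
    (hy₁ : branch (-s) y₁ = 0) (hy₂ : branch (-s) y₂ = 0)
    (hx : branch s x = 0) (hx' : branch s x' = 0)
    (hodd : oddCoeff1.eval m₀ r₀ ≠ 0) (hc : c ≠ 0) {b b' : Bool}
    (hM : evalX m₀ r₀ (π x) sexticOdd ≠ 0) (hM' : evalX m₀ r₀ (π x') sexticOdd ≠ 0)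
    (hU : evalX m₀ r₀ (π x) sexticEven = bif b then -(c * evalX m₀ r₀ (π x) sexticOdd)
      else c * evalX m₀ r₀ (π x) sexticOdd)
    (hU' : evalX m₀ r₀ (π x') sexticEven = bif b' then -(c * evalX m₀ r₀ (π x') sexticOdd)
      else c * evalX m₀ r₀ (π x') sexticOdd) :
    PairRel (ι s) (ι y₁) (ι y₂) (ι x) (ι x') ↔ b = b' := by
  have : IsDomain O := hι.isDomain ι
  obtain ⟨m, r, hp, rfl, rfl⟩ := exists_isPair_lift hπ h hn
  have hnO : Nondegenerate y₁ y₂ m := hn.of_map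
  have h2O : (2 : O) ≠ 0 := fun h => h2 (by simpa [map_ofNat] using congrArg π h)
  have hoddO : oddCoeff1.eval m r ≠ 0 := fun h => hodd (by
    rw [← BiExpr.map_eval, h, map_zero])
  have e := hp.sextic_sq hnO hy₁ hy₂ h2O hx
  have e' := hp.sextic_sq hnO hy₁ hy₂ h2O hx'
  have hsq : (evalX m r x sexticEven * evalX m r x' sexticOdd) ^ 2 =
      (evalX m r x' sexticEven * evalX m r x sexticOdd) ^ 2 := by
    refine mul_left_cancel₀ hoddO ?_
    linear_combination evalX m r x' sexticOdd ^ 2 * e - evalX m r x sexticOdd ^ 2 * e'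
  have hne : c * evalX (π m) (π r) (π x) sexticOdd * evalX (π m) (π r) (π x') sexticOdd ≠ 0 :=
    mul_ne_zero (mul_ne_zero hc hM) hM'
  have hred : ∀ y z, evalX (π m) (π r) (π y) sexticEven * evalX (π m) (π r) (π z) sexticOdd =
      π (evalX m r y sexticEven * evalX m r z sexticOdd) := fun y z => by
    rw [map_mul, map_evalX, map_evalX]
  have key : evalX m r x sexticEven * evalX m r x' sexticOdd =
      evalX m r x' sexticEven * evalX m r x sexticOdd ↔ b = b' := by
    constructor
    · intro he
      have := congrArg π he
      rw [← hred, ← hred, hU, hU'] at this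
      by_contra hb
      refine hne ((mul_eq_zero.1 (?_ : (2 : k) * _ = 0)).resolve_left h2)
      cases b <;> cases b' <;> simp only [not_true_eq_false, cond_true, cond_false] at hb this
      · linear_combination this
      · linear_combination -this
    · rintro rfl
      refine (sq_eq_sq_iff_eq_or_eq_neg.1 hsq).resolve_right fun he => ?_
      have := congrArg π he
      rw [map_neg, ← hred, ← hred, hU, hU'] at this
      refine hne ((mul_eq_zero.1 (?_ : (2 : k) * _ = 0)).resolve_left h2)
      cases b <;> simp only [cond_true, cond_false] at this
      · linear_combination this
      · linear_combination -this
  rw [← key]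
  constructor
  · rintro ⟨m', r', hp', he⟩
    obtain ⟨rfl, rfl⟩ := (hp.map ι).unique (hnO.map hι) hp'
    rw [← map_evalX, ← map_evalX, ← map_evalX, ← map_evalX, ← map_mul, ← map_mul] at he
    exact hι he
  · intro he
    refine ⟨ι m, ι r, hp.map ι, ?_⟩
    rw [← map_evalX, ← map_evalX, ← map_evalX, ← map_evalX, ← map_mul, ← map_mul, he]

end

end Pairs

/-! ### A totally split place -/

section SplitPlace

theorem prime_2203 : Nat.Prime 2203 := by norm_num

instance : Fact (Nat.Prime 2203) := ⟨prime_2203⟩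

namespace BiExpr

/-- The value of a polynomial with coefficients in `BiExpr`, computed modulo `M`. -/
def evalXMod (M m r x : ℕ) : List BiExpr → ℕ
  | [] => 0
  | a :: l => Nat.mod (Nat.add (a.evalMod M m r) (Nat.mul x (evalXMod M m r x l))) M

theorem evalXMod_cast {M : ℕ} (hM : 0 < M) (m r x : ℕ) (l : List BiExpr) :
    (evalXMod M m r x l : ZMod M) = evalX (m : ZMod M) (r : ZMod M) (x : ZMod M) l := by
  induction l with
  | nil => simp [evalXMod, evalX]
  | cons a l ih =>
    rw [evalX, ← ih, ← evalMod_cast hM, ← Nat.cast_mul, ← Nat.cast_add,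
      ← ZMod.natCast_mod (a.evalMod M m r + _)]
    rfl

end BiExpr

namespace PairDatum

open BiExpr

/-- The roots of `dodecic 611` modulo `2203`. -/
def rootX : Fin 12 → ℕ := ![6, 171, 433, 918, 959, 1573, 983, 1244, 1509, 1581, 1771, 2070]

/-- The roots of `dodecic (-611)` modulo `2203`. -/
def rootY : Fin 12 → ℕ := ![229, 698, 775, 794, 802, 836, 1274, 1388, 1457, 1490, 1626, 1849]

/-- The values of the second coordinate on the conic at the roots of `dodecic (-611)`. -/
def rootW : Fin 12 → ℕ := ![221, 333, 1596, 979, 536, 1947, 1021, 1388, 1003, 393, 189, 1601]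

theorem rootX_injective : ∀ a b, (rootX a : ZMod 2203) = rootX b → a = b := by decide +kernel

theorem rootY_injective : ∀ a b, (rootY a : ZMod 2203) = rootY b → a = b := by decide +kernel

theorem branch_rootX : ∀ a, branch (611 : ZMod 2203) (rootX a) = 0 := by decide +kernel

theorem branch_rootY : ∀ i, branch (-611 : ZMod 2203) (rootY i) = 0 := by decide +kernel

theorem rootW_spec : ∀ i, 4 * evalList (rootY i : ZMod 2203) coeffsG ≠ 0 ∧
    4 * evalList (rootY i : ZMod 2203) coeffsG * rootW i =
      -(611 + evalList (rootY i : ZMod 2203) coeffsA) := by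
  decide +kernel

theorem isPair_of_mem_list : ∀ d ∈ list,
    ((d.m : ZMod 2203) * (rootY d.i - rootY d.j) = rootW d.i - rootW d.j ∧
      (1 + (d.m : ZMod 2203) ^ 2) * d.r = rootW d.i - d.m * (rootY d.i - 20)) ∧
    (rootY d.i : ZMod 2203) - rootY d.j ≠ 0 ∧ 1 + (d.m : ZMod 2203) ^ 2 ≠ 0 ∧
      (d.c : ZMod 2203) ≠ 0 ∧ d.i ≠ d.j := by
  decide +kernel

/-- Checks the values of the two sextics at the roots of `dodecic 611`. -/
def checkSextics (d : PairDatum) : Bool :=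
  (!Nat.beq (Nat.mod (oddCoeff1.evalMod 2203 d.m d.r) 2203) 0) &&
    (List.finRange 12).all fun a =>
      let u := evalXMod 2203 d.m d.r (rootX a) sexticEven
      let v := evalXMod 2203 d.m d.r (rootX a) sexticOdd
      (!Nat.beq (Nat.mod v 2203) 0) && Nat.beq (Nat.mod u 2203)
        (Nat.mod (Nat.mul (bif d.mask.testBit a then Nat.sub 2203 d.c else d.c) v) 2203)

theorem checkSextics_eq_true : (list.all fun d => (Nat.ble d.c 2203) && d.checkSextics) = true := by
  decide +kernel

theorem exists_mem_list : ∀ i j : Fin 12, i ≠ j →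
    ∃ d ∈ list, (d.i = i ∧ d.j = j) ∨ (d.i = j ∧ d.j = i) := by
  decide +kernel

theorem oddCoeff1_ne_zero {d : PairDatum} (hd : d ∈ list) :
    oddCoeff1.eval (d.m : ZMod 2203) (d.r : ZMod 2203) ≠ 0 := by
  have h := List.all_eq_true.1 checkSextics_eq_true d hd
  simp only [checkSextics, Bool.and_eq_true, Bool.not_eq_true'] at h
  rw [← evalMod_cast (by norm_num), Ne, ZMod.natCast_eq_zero_iff, Nat.dvd_iff_mod_eq_zero]
  exact Nat.ne_of_beq_eq_false h.2.1

theorem sextic_spec {d : PairDatum} (hd : d ∈ list) (a : Fin 12) :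
    evalX (d.m : ZMod 2203) d.r (rootX a) sexticOdd ≠ 0 ∧
      evalX (d.m : ZMod 2203) d.r (rootX a) sexticEven = bif d.mask.testBit a then
        -(d.c * evalX (d.m : ZMod 2203) d.r (rootX a) sexticOdd)
      else d.c * evalX (d.m : ZMod 2203) d.r (rootX a) sexticOdd := by
  have h := List.all_eq_true.1 checkSextics_eq_true d hd
  simp only [checkSextics, Bool.and_eq_true, Bool.not_eq_true', List.all_eq_true, Nat.ble_eq] at h
  obtain ⟨hc, -, h⟩ := h
  obtain ⟨h1, h2⟩ := h a (List.mem_finRange a)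
  rw [← evalXMod_cast (by norm_num), ← evalXMod_cast (by norm_num)]
  constructor
  · rw [Ne, ZMod.natCast_eq_zero_iff, Nat.dvd_iff_mod_eq_zero]
    exact Nat.ne_of_beq_eq_false h1
  · have h3 := (ZMod.natCast_eq_natCast_iff' _ _ 2203).2 (Nat.eq_of_beq_eq_true h2)
    rw [h3]
    generalize evalXMod 2203 d.m d.r (rootX a) sexticOdd = v
    generalize d.mask.testBit a = b
    rw [Nat.mul_eq, Nat.cast_mul]
    cases b
    · rfl
    · rw [cond_true, cond_true, Nat.sub_eq, Nat.cast_sub hc, ZMod.natCast_self, zero_sub, neg_mul]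

end PairDatum

/-- Lifts of a complete set of reduced roots of `dodecic s`. -/
theorem exists_lift_roots {O k Ω : Type*} [CommRing O] [Field k] [Field Ω] {ι : O →+* Ω}
    (hι : Function.Injective ι) (π : O →+* k) {S : O} (hsplit : (dodecic (ι S)).Splits)
    (hlift : ∀ x, branch (ι S) x = 0 → ∃ o, ι o = x) {xs : Fin 12 → k}
    (hxs : Function.Injective xs) (h : ∀ a, branch (π S) (xs a) = 0) :
    ∃ os : Fin 12 → O, (∀ a, π (os a) = xs a) ∧ (∀ a, branch S (os a) = 0) ∧
      ∀ x, branch (ι S) x = 0 → ∃ a, ι (os a) = x := by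
  obtain ⟨os, hos⟩ := exists_dodecic_eq_prod ι hι S hsplit hlift
  have hex : ∀ a, ∃ i, π (os i) = xs a := by
    intro a
    have := h a
    rw [← eval_dodecic, ← map_dodecic, hos, Polynomial.map_prod, eval_prod,
      Finset.prod_eq_zero_iff] at this
    obtain ⟨i, -, hi⟩ := this
    exact ⟨i, by simpa [sub_eq_zero, @eq_comm _ (xs a)] using hi⟩
  choose e he using hex
  have hinj : Function.Injective e := fun a b hab => hxs (by rw [← he, ← he, hab])
  refine ⟨os ∘ e, he, fun a => ?_, fun x hx => ?_⟩
  · rw [← eval_dodecic, hos, eval_prod]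
    exact Finset.prod_eq_zero (Finset.mem_univ (e a)) (by simp)
  · rw [← eval_dodecic, ← map_dodecic, hos, Polynomial.map_prod, eval_prod,
      Finset.prod_eq_zero_iff] at hx
    obtain ⟨i, -, hi⟩ := hx
    obtain ⟨a, rfl⟩ := (Finite.injective_iff_surjective.1 hinj) i
    exact ⟨a, by simpa [sub_eq_zero, @eq_comm _ x] using hi⟩

universe u

open BiExpr

variable {Ω : Type u} [Field Ω] [Algebra (RatFunc ℚ) Ω] [FiniteDimensional (RatFunc ℚ) Ω]
  [IsGalois (RatFunc ℚ) Ω] {s : Ω}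

/-- An enumeration of the roots of `dodecic s` and `dodecic (-s)` for which the relations attached
to pairs of roots are known. -/
theorem exists_enumeration
    (hs : s ^ 2 = algebraMap (RatFunc ℚ) Ω ((scale : RatFunc ℚ) * (RatFunc.X - 1)))
    (hτ : ∃ τ : Ω ≃ₐ[RatFunc ℚ] Ω, τ s = -s) (hsplit : (dodecic s).Splits)
    (hsplit' : (dodecic (-s)).Splits) :
    ∃ x y : Fin 12 → Ω, Function.Injective x ∧ Function.Injective y ∧
      (∀ z, branch s z = 0 ↔ ∃ a, x a = z) ∧ (∀ z, branch (-s) z = 0 ↔ ∃ i, y i = z) ∧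
      ∀ d ∈ PairDatum.list, ∀ a b, PairRel s (y d.i) (y d.j) (x a) (x b) ↔ d.same a b = true := by
  obtain ⟨τ, hτ⟩ := hτ
  obtain ⟨O, k, _, _, _, ι, π, -, hι, hunit, ⟨S, rfl, hπS⟩, -, hlift, -⟩ :=
    exists_place hs τ hτ (p := 2203) 611 (by decide +kernel) (by decide +kernel) (by decide +kernel)
  let f := algebraMap (ZMod 2203) k
  have hf : Function.Injective f := f.injective
  have h611 : π S = 611 := by rw [hπS, map_ofNat]
  obtain ⟨xs, hxs, hxb, hx⟩ := exists_lift_roots hι π hsplit (fun x hx => hlift x (.inl hx))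
    (xs := fun a => f (PairDatum.rootX a))
    (fun a b h => PairDatum.rootX_injective a b (hf h)) fun a => by
      rw [hπS, ← map_branch, PairDatum.branch_rootX, map_zero]
  rw [← map_neg] at hsplit'
  obtain ⟨ys, hys, hyb, hy⟩ := exists_lift_roots hι π hsplit' (fun x hx => hlift x (.inr (by
      rwa [map_neg] at hx)))
    (xs := fun a => f (PairDatum.rootY a))
    (fun a b h => PairDatum.rootY_injective a b (hf h)) fun a => by
      rw [map_neg, hπS, ← map_neg, ← map_branch, PairDatum.branch_rootY, map_zero]
  refine ⟨ι ∘ xs, ι ∘ ys, hι.comp fun a b h => ?_, hι.comp fun a b h => ?_, fun z => ⟨hx z, ?_⟩,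
    fun z => ⟨fun h => hy z (by rwa [map_neg]), ?_⟩, fun d hd a b => ?_⟩
  · refine PairDatum.rootX_injective a b (hf ?_)
    rw [← hxs, ← hxs, h]
  · refine PairDatum.rootY_injective a b (hf ?_)
    rw [← hys, ← hys, h]
  · rintro ⟨a, rfl⟩
    exact (map_branch ι S (xs a)).symm.trans (by rw [hxb, map_zero])
  · rintro ⟨a, rfl⟩
    rw [← map_neg]
    exact (map_branch ι (-S) (ys a)).symm.trans (by rw [hyb, map_zero])
  · obtain ⟨⟨e1, e2⟩, n1, n2, n3, -⟩ := PairDatum.isPair_of_mem_list d hd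
    have hp : IsPair (611 : ZMod 2203) (PairDatum.rootY d.i) (PairDatum.rootY d.j) d.m d.r :=
      ⟨_, _, (PairDatum.rootW_spec d.i).2, (PairDatum.rootW_spec d.j).2, e1, e2⟩
    have hn : Nondegenerate (PairDatum.rootY d.i : ZMod 2203) (PairDatum.rootY d.j) d.m :=
      ⟨(PairDatum.rootW_spec d.i).1, (PairDatum.rootW_spec d.j).1, n1, n2⟩
    have hU : ∀ a, evalX (f d.m) (f d.r) (π (xs a)) sexticOdd ≠ 0 ∧
        evalX (f d.m) (f d.r) (π (xs a)) sexticEven = bif d.mask.testBit a then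
          -(f d.c * evalX (f d.m) (f d.r) (π (xs a)) sexticOdd)
        else f d.c * evalX (f d.m) (f d.r) (π (xs a)) sexticOdd := by
      intro a
      obtain ⟨h1, h2⟩ := PairDatum.sextic_spec hd a
      rw [hxs, ← map_evalX, ← map_evalX]
      refine ⟨(map_ne_zero f).2 h1, ?_⟩
      rw [h2]
      cases d.mask.testBit a <;> simp
    rw [PairDatum.same, beq_iff_eq]
    refine pairRel_iff (c := f d.c) hι hunit (m₀ := f d.m) (r₀ := f d.r) ?_ ?_ ?_
      (hyb _) (hyb _) (hxb _) (hxb _) ?_ ((map_ne_zero f).2 n3) (hU a).1 (hU b).1 (hU a).2 (hU b).2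
    · intro h
      have h2 : (2 : ZMod 2203) ≠ 0 := by decide +kernel
      exact h2 (hf (by rw [map_ofNat, map_zero, h]))
    · rw [hys, hys, hπS]
      exact hp.map f
    · rw [hys, hys]
      exact hn.map hf
    · rw [← map_eval]
      exact (map_ne_zero f).2 (PairDatum.oddCoeff1_ne_zero hd)

end SplitPlace

/-! ### The order of the stabilizer -/

section StabilizerCard

universe u

variable {Ω : Type u} [Field Ω] [Algebra (RatFunc ℚ) Ω] {s : Ω}

theorem exists_perm_of_enumeration {r : Ω} {x : Fin 12 → Ω} (hx : Function.Injective x)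
    (hroot : ∀ z, branch r z = 0 ↔ ∃ a, x a = z) {σ : Ω ≃ₐ[RatFunc ℚ] Ω} (hσ : σ r = r) :
    ∃ α : Equiv.Perm (Fin 12), ∀ a, σ (x a) = x (α a) := by
  have h : ∀ a, ∃ b, x b = σ (x a) := by
    intro a
    rw [← hroot]
    have h0 := congrArg (σ : Ω →+* Ω) ((hroot (x a)).2 ⟨a, rfl⟩)
    rw [map_branch, map_zero] at h0
    change branch (σ r) (σ (x a)) = 0 at h0
    rwa [hσ] at h0
  choose α hα using h
  have hinj : Function.Injective α := fun a b hab => hx (σ.injective (by rw [← hα, ← hα, hab]))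
  exact ⟨Equiv.ofBijective α (Finite.injective_iff_bijective.1 hinj), fun a => (hα a).symm⟩

theorem pairRel_map_iff {σ : Ω ≃ₐ[RatFunc ℚ] Ω} (hσ : σ s = s) (y₁ y₂ x x' : Ω) :
    PairRel s (σ y₁) (σ y₂) (σ x) (σ x') ↔ PairRel s y₁ y₂ x x' := by
  have hσ' : σ.symm s = s := by rw [AlgEquiv.symm_apply_eq, hσ]
  constructor
  · intro h
    simpa [hσ'] using h.map (σ.symm : Ω →+* Ω)
  · intro h
    simpa [hσ] using h.map (σ : Ω →+* Ω)

variable {x y : Fin 12 → Ω} (hxinj : Function.Injective x) (hyinj : Function.Injective y)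
  (hx : ∀ z, branch s z = 0 ↔ ∃ a, x a = z) (hy : ∀ z, branch (-s) z = 0 ↔ ∃ i, y i = z)
  (hrel : ∀ d ∈ PairDatum.list, ∀ a b,
    PairRel s (y d.i) (y d.j) (x a) (x b) ↔ d.same a b = true)

include hxinj hyinj hx hy hrel in
/-- An automorphism fixing five roots of `dodecic s` fixes all roots of `dodecic s` and
`dodecic (-s)`. -/
theorem fixes_roots_of_fixes_five {σ : Ω ≃ₐ[RatFunc ℚ] Ω} (hσ : σ s = s)
    (h5 : ∀ a < 5, σ (x a) = x a) {z : Ω} (hz : branch s z = 0 ∨ branch (-s) z = 0) : σ z = z := by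
  obtain ⟨α, hα⟩ := exists_perm_of_enumeration hxinj hx hσ
  obtain ⟨β, hβ⟩ := exists_perm_of_enumeration hyinj hy (σ := σ) (by rw [map_neg, hσ])
  have key : ∀ d ∈ PairDatum.list, ∃ d' ∈ PairDatum.list,
      ((d'.i = β d.i ∧ d'.j = β d.j) ∨ (d'.i = β d.j ∧ d'.j = β d.i)) ∧
      ∀ a b, d.same a b = d'.same (α a) (α b) := by
    intro d hd
    obtain ⟨d', hd', h⟩ := PairDatum.exists_mem_list (β d.i) (β d.j)
      (β.injective.ne (PairDatum.isPair_of_mem_list d hd).2.2.2.2)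
    refine ⟨d', hd', h, fun a b => ?_⟩
    rw [Bool.eq_iff_iff, ← hrel d hd, ← hrel d' hd', ← pairRel_map_iff hσ, hα, hα, hβ, hβ]
    rcases h with ⟨h1, h2⟩ | ⟨h1, h2⟩
    · rw [h1, h2]
    · rw [h1, h2]
      exact ⟨PairRel.symm, PairRel.symm⟩
  have hα1 : α = 1 := by
    refine PairDatum.IsSymmetry.eq_one (fun d hd => ?_) fun a ha => hxinj (by rw [← hα, h5 a ha])
    obtain ⟨d', hd', -, h⟩ := key d hd
    exact ⟨d', hd', h⟩
  subst hα1
  have hβ1 : ∀ i, β i = i := by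
    intro i
    by_contra hne
    have hex : ∀ i i' : Fin 12, ∃ j, j ≠ i ∧ j ≠ i' := by decide
    obtain ⟨j, hji, hj⟩ := hex i (β i)
    obtain ⟨d, hd, hij⟩ := PairDatum.exists_mem_list i j hji.symm
    obtain ⟨d', hd', h, hs⟩ := key d hd
    obtain ⟨h1, h2⟩ := PairDatum.eq_of_same d hd d' hd' hs
    rcases hij with ⟨rfl, rfl⟩ | ⟨rfl, rfl⟩ <;> rcases h with ⟨h3, h4⟩ | ⟨h3, h4⟩
    · exact hne (h3.symm.trans h1.symm)
    · exact hj (h2.trans h4)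
    · exact hne (h4.symm.trans h2.symm)
    · exact hj (h1.trans h3)
  rcases hz with hz | hz
  · obtain ⟨a, rfl⟩ := (hx z).1 hz
    exact hα a
  · obtain ⟨i, rfl⟩ := (hy z).1 hz
    rw [hβ, hβ1]

/-- The stabilizer of `s` has order `95040` when `Ω` is generated by the roots of `dodecic s` and
`dodecic (-s)`. -/
theorem card_stabilizer [FiniteDimensional (RatFunc ℚ) Ω] [IsGalois (RatFunc ℚ) Ω]
    (hs : s ^ 2 = algebraMap (RatFunc ℚ) Ω ((scale : RatFunc ℚ) * (RatFunc.X - 1)))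
    (hτ : ∃ τ : Ω ≃ₐ[RatFunc ℚ] Ω, τ s = -s) (hsplit : (dodecic s).Splits)
    (hsplit' : (dodecic (-s)).Splits)
    (hgen : ∀ σ : Ω ≃ₐ[RatFunc ℚ] Ω,
      (∀ z, branch s z = 0 ∨ branch (-s) z = 0 → σ z = z) → σ = 1) :
    Nat.card (MulAction.stabilizer (Ω ≃ₐ[RatFunc ℚ] Ω) s) = 95040 := by
  classical
  obtain ⟨x, y, hxinj, hyinj, hx, hy, hrel⟩ := exists_enumeration hs hτ hsplit hsplit'
  let e : Fin 12 ≃ RootSet s := Equiv.ofBijective (fun a => ⟨x a, (hx _).2 ⟨a, rfl⟩⟩)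
    ⟨fun a b h => hxinj (congrArg Subtype.val h), fun z => by
      obtain ⟨a, ha⟩ := (hx z.1).1 z.2
      exact ⟨a, Subtype.ext ha⟩⟩
  let _ : Fintype (RootSet s) := Fintype.ofEquiv _ e
  have hcard : Fintype.card (RootSet s) = 12 := by
    rw [← Fintype.card_congr e, Fintype.card_fin]
  have hfix : ∀ g g' : MulAction.stabilizer (Ω ≃ₐ[RatFunc ℚ] Ω) s,
      (∀ a < 5, g • e a = g' • e a) → g = g' := by
    intro g g' h
    rw [← inv_mul_eq_one]
    refine Subtype.ext (hgen _ fun z hz => ?_)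
    refine fixes_roots_of_fixes_five hxinj hyinj hx hy hrel (g⁻¹ * g').2 (fun a ha => ?_) hz
    refine congrArg Subtype.val (?_ : (g⁻¹ * g') • e a = e a)
    rw [mul_smul, ← h a ha, inv_smul_smul]
  have : FaithfulSMul (MulAction.stabilizer (Ω ≃ₐ[RatFunc ℚ] Ω) s) (RootSet s) :=
    ⟨fun h => hfix _ _ fun a _ => h (e a)⟩
  have hle : Nat.card (MulAction.stabilizer (Ω ≃ₐ[RatFunc ℚ] Ω) s) ≤ 95040 := by
    let F : MulAction.stabilizer (Ω ≃ₐ[RatFunc ℚ] Ω) s → (Fin 5 ↪ RootSet s) := fun g =>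
      ⟨fun k => g • e (Fin.castLE (by norm_num) k), fun k l h =>
        Fin.castLE_injective _ (e.injective (MulAction.injective g h))⟩
    have hF : Function.Injective F := by
      refine fun g g' h => hfix g g' fun a ha => ?_
      exact DFunLike.congr_fun h (⟨a, ha⟩ : Fin 5)
    refine (Nat.card_le_card_of_injective F hF).trans ?_
    rw [Nat.card_eq_fintype_card, Fintype.card_embedding_eq, hcard, Fintype.card_fin]
    decide
  obtain ⟨⟨h02, h11, h25, h33⟩, h22, h44, h8⟩ := stabilizer_hasCycles hs hτ hsplit
  exact card_eq_95040 hcard hle h02 h11 h25 h22 h33 h44 h8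

end StabilizerCard

/-! ### The quadratic subextension -/

section Quadratic

universe u

theorem scale_mul_eq_algebraMap : (scale : RatFunc ℚ) * (RatFunc.X - 1) =
    algebraMap ℚ[X] (RatFunc ℚ) (C (scale : ℚ) * (X - C 1)) := by
  simp [RatFunc.algebraMap_X]

theorem not_isSquare_scale_mul : ¬ IsSquare ((scale : RatFunc ℚ) * (RatFunc.X - 1)) := by
  rintro ⟨q, hq⟩
  have hscale : (scale : ℚ) ≠ 0 := by norm_num [scale]
  have hdeg : ((scale : RatFunc ℚ) * (RatFunc.X - 1)).intDegree = 1 := by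
    rw [scale_mul_eq_algebraMap, RatFunc.intDegree_polynomial, natDegree_C_mul hscale,
      natDegree_X_sub_C]
    rfl
  have hq0 : q ≠ 0 := by
    rintro rfl
    rw [hq] at hdeg
    simp at hdeg
  rw [hq, RatFunc.intDegree_mul hq0 hq0] at hdeg
  omega

theorem isIntegral_of_evalList_eq_zero {R : Type*} [CommRing R] {x : R}
    (h : evalList x BiExpr.coeffsA = 0) : IsIntegral ℤ x := by
  refine ⟨evalList X BiExpr.coeffsA, ?_, ?_⟩
  · simp only [evalList, BiExpr.coeffsA, mul_zero, add_zero, Int.cast_one, mul_one, Int.cast_zero,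
      zero_add]
    monicity!
  · rw [← coe_eval₂RingHom, map_evalList]
    simpa using h

theorem isIntegral_evalList {R : Type*} [CommRing R] {x : R} (h : IsIntegral ℤ x) (l : List ℤ) :
    IsIntegral ℤ (evalList x l) := by
  induction l with
  | nil => exact isIntegral_zero
  | cons a l ih => exact (isIntegral_algebraMap (x := a)).add (h.mul ih)

theorem eval₂_scale_mul_ne_zero {p : ℤ[X]} (hp : p.Monic) :
    eval₂ (Int.castRingHom (RatFunc ℚ)) ((scale : RatFunc ℚ) * (RatFunc.X - 1)) p ≠ 0 := by
  intro h
  have hz : (p.map (Int.castRingHom ℚ)).comp (C (scale : ℚ) * (X - C 1)) = 0 := by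
    apply RatFunc.algebraMap_injective ℚ
    rw [comp, eval₂_map, hom_eval₂, ← scale_mul_eq_algebraMap, map_zero, ← h]
    congr 1
    exact RingHom.ext_int _ _
  rcases comp_eq_zero_iff.1 hz with h | ⟨-, h⟩
  · exact (hp.map _).ne_zero h
  · have := congrArg natDegree h
    rw [natDegree_C, natDegree_C_mul (by norm_num [scale]), natDegree_X_sub_C] at this
    exact one_ne_zero this

variable {Ω : Type u} [Field Ω] [Algebra (RatFunc ℚ) Ω] {s : Ω}

theorem exists_sq_eq_of_splits
    (h : ((normPoly ((scale : RatFunc ℚ) * (RatFunc.X - 1))).map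
      (algebraMap (RatFunc ℚ) Ω)).Splits) :
    ∃ s : Ω, s ^ 2 = algebraMap (RatFunc ℚ) Ω ((scale : RatFunc ℚ) * (RatFunc.X - 1)) := by
  have hdeg : (normPoly (algebraMap (RatFunc ℚ) Ω
      ((scale : RatFunc ℚ) * (RatFunc.X - 1)))).degree ≠ 0 := by
    refine (natDegree_pos_iff_degree_pos.1 ?_).ne'
    rw [natDegree_normPoly]
    norm_num
  rw [map_normPoly] at h
  obtain ⟨x, hx⟩ := h.exists_eval_eq_zero hdeg
  set c := (scale : RatFunc ℚ) * (RatFunc.X - 1) with hc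
  rw [normPoly, ← coe_evalRingHom] at hx
  simp only [map_sub, map_mul, map_pow, map_add, map_evalList, coe_evalRingHom, eval_X, eval_C,
    map_ofNat] at hx
  have : CharZero Ω := charZero_of_injective_algebraMap (algebraMap (RatFunc ℚ) Ω).injective
  have hA : evalList x BiExpr.coeffsA ≠ 0 := by
    intro hA
    have hS : algebraMap (RatFunc ℚ) Ω c = -evalList x BiExpr.coeffsS := by
      rw [hA] at hx
      refine eq_neg_of_add_eq_zero_right (pow_eq_zero_iff two_ne_zero |>.1 ?_)
      linear_combination hx
    obtain ⟨p, hp, hpc⟩ := (isIntegral_evalList (isIntegral_of_evalList_eq_zero hA)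
      BiExpr.coeffsS).neg
    refine eval₂_scale_mul_ne_zero hp ((algebraMap (RatFunc ℚ) Ω).injective ?_)
    rw [hom_eval₂, ← hc, hS, map_zero, ← hpc]
    congr 1
    exact RingHom.ext_int _ _
  refine ⟨(evalList x BiExpr.coeffsS + algebraMap (RatFunc ℚ) Ω c) /
    (2 * evalList x BiExpr.coeffsA), ?_⟩
  rw [div_pow, div_eq_iff (by simpa using hA)]
  linear_combination hx

variable (hs : s ^ 2 = algebraMap (RatFunc ℚ) Ω ((scale : RatFunc ℚ) * (RatFunc.X - 1)))

include hs

theorem exists_neg_of_sq_eq [FiniteDimensional (RatFunc ℚ) Ω] [IsGalois (RatFunc ℚ) Ω] :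
    ∃ τ : Ω ≃ₐ[RatFunc ℚ] Ω, τ s = -s := by
  by_contra! h
  have hfix : ∀ σ : Ω ≃ₐ[RatFunc ℚ] Ω, σ s = s := fun σ =>
    (eq_or_eq_neg_of_sq_mem hs σ).resolve_right (h σ)
  obtain ⟨q, rfl⟩ := (IsGalois.mem_range_algebraMap_iff_fixed s).2 hfix
  refine not_isSquare_scale_mul ⟨q, ?_⟩
  rw [← pow_two]
  exact (algebraMap (RatFunc ℚ) Ω).injective (by rw [← hs, map_pow])

theorem card_eq_two_mul_card_stabilizer (hτ : ∃ τ : Ω ≃ₐ[RatFunc ℚ] Ω, τ s = -s) :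
    Nat.card (Ω ≃ₐ[RatFunc ℚ] Ω) = Nat.card (MulAction.stabilizer (Ω ≃ₐ[RatFunc ℚ] Ω) s) * 2 := by
  have hne : s ≠ -s := by
    have : CharZero Ω := charZero_of_injective_algebraMap (algebraMap (RatFunc ℚ) Ω).injective
    rw [Ne, self_eq_neg]
    rintro rfl
    refine not_isSquare_scale_mul ⟨0, (algebraMap (RatFunc ℚ) Ω).injective ?_⟩
    rw [← hs]
    simp
  have horbit : MulAction.orbit (Ω ≃ₐ[RatFunc ℚ] Ω) s = {s, -s} := by
    ext z
    constructor
    · rintro ⟨σ, rfl⟩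
      exact eq_or_eq_neg_of_sq_mem hs σ
    · rintro (rfl | rfl)
      exacts [MulAction.mem_orbit_self _, hτ]
  rw [← Subgroup.card_mul_index (MulAction.stabilizer (Ω ≃ₐ[RatFunc ℚ] Ω) s),
    MulAction.index_stabilizer, horbit, Set.ncard_pair hne]

omit hs

/-- The Galois group of the norm of `dodecic s`. -/
theorem card_gal_normPoly :
    Nat.card (normPoly ((scale : RatFunc ℚ) * (RatFunc.X - 1))).Gal = 190080 := by
  set f := normPoly ((scale : RatFunc ℚ) * (RatFunc.X - 1)) with hf
  have hsplits := SplittingField.splits f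
  have hfmap : ∀ {s : f.SplittingField},
      s ^ 2 = algebraMap _ _ ((scale : RatFunc ℚ) * (RatFunc.X - 1)) →
      f.map (algebraMap (RatFunc ℚ) f.SplittingField) = dodecic s * dodecic (-s) := by
    intro s hs
    rw [← normPoly_sq, hs, map_normPoly]
  have : Algebra.IsSeparable (RatFunc ℚ) f.SplittingField := inferInstance
  have : IsGalois (RatFunc ℚ) f.SplittingField := ⟨⟩
  obtain ⟨s, hs⟩ := exists_sq_eq_of_splits hsplits
  have hroots : ∀ z : f.SplittingField,
      z ∈ f.rootSet f.SplittingField → branch s z = 0 ∨ branch (-s) z = 0 := by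
    intro z hz
    have := (mem_rootSet'.1 hz).2
    rw [← eval_map_algebraMap, hfmap hs, eval_mul, eval_dodecic, eval_dodecic] at this
    exact mul_eq_zero.1 this
  have hf0 : f.map (algebraMap (RatFunc ℚ) f.SplittingField) ≠ 0 := by
    rw [hfmap hs]
    exact ((monic_dodecic s).mul (monic_dodecic (-s))).ne_zero
  have hτ := exists_neg_of_sq_eq hs
  have hH := card_stabilizer hs hτ (hsplits.of_dvd hf0 (hfmap hs ▸ dvd_mul_right _ _))
    (hsplits.of_dvd hf0 (hfmap hs ▸ dvd_mul_left _ _))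
    fun σ h => Gal.ext f fun z hz => h z (hroots z hz)
  have hindex := card_eq_two_mul_card_stabilizer hs hτ
  rw [hH] at hindex
  exact hindex

end Quadratic

/-- The polynomial `f_{E2}(t,x)` has Galois group over `ℚ(t)` of order
`190080`, the order of `M₁₂.2 = Aut(M₁₂)`. -/
theorem galois_group_of_fE2_has_card_M12_2 :
    let t : Polynomial (RatFunc ℚ) := C RatFunc.X
    let fE2 : Polynomial (RatFunc ℚ) :=
      (1 - t) * (X ^ 6 - 20 * X ^ 5 + 262 * X ^ 4 - 15286 * X ^ 3 + 477665 * X ^ 2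
            - 10170814 * X + 96944940) ^ 3
          * (X ^ 6 + 60 * X ^ 5 + 2406 * X ^ 4 + 56114 * X ^ 3 + 1941921 * X ^ 2
            + 55625130 * X + 996578748)
        + t * (X ^ 12 + 396 * X ^ 10 - 27192 * X ^ 9 + 933174 * X ^ 8 - 20101752 * X ^ 7
            + 169737744 * X ^ 6 - 16330240872 * X ^ 5 + 538400028969 * X ^ 4
            - 8234002812376 * X ^ 3 + 195276967064388 * X ^ 2 - 3991355037576144 * X
            + 30911476378259268) ^ 2
        + 2 ^ 4 * 3 ^ 12 * 11 ^ 22 * t * (t - 1)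
    Nat.card fE2.Gal = 190080 := by
  intro t fE2
  have hf : fE2 = normPoly ((scale : RatFunc ℚ) * (RatFunc.X - 1)) := by
    simp only [fE2, t, normPoly, evalList, BiExpr.coeffsS, BiExpr.coeffsA, scale, C_mul, C_sub, C_1,
      map_intCast]
    generalize (C RatFunc.X : (RatFunc ℚ)[X]) = t
    push_cast
    ring
  rw [hf]
  exact card_gal_normPoly
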